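/- arXiv:2412.02337 — 2 statements merged into one kernel-verified Lean document; each statement's English description precedes it below -/
import Mathlib

section
/- Let σ ≤ 0, d > 0, and θ be fixed real numbers, fix constants C_2 > C_1 > 1, let X be an integer with 2 ≤ X ≤ min(M, N), and for a positive integer m set H_2(m) = d·log(m/(dX)) + θ and f_{m,h}(u) = F_m(u) − h·u. Then for all integers N, M ≥ 2 with C_1·N ≤ M ≤ C_2·N: |Σ_{m=1}^M (1/m^{1−σ}) Σ_{h ∈ ℤ, H_2(m)−2d ≤ h ≤ H_2(m)+d} ∫_X^N e^{2πi f_{m,h}(u)}/u^{1/2} du| ≤ C·(X^{1/2}·log X + X^{−1/2}·log N) if σ = 0, and ≤ C if σ < 0, where C depends only on σ, d, θ, C_1, C_2. -/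
/-- `Fm d θ m u = d·u·log(e·m/(d·u)) + θ·u`. -/
noncomputable def Fm (d θ : ℝ) (m : ℕ) (u : ℝ) : ℝ :=
  d * u * Real.log (Real.exp 1 * m / (d * u)) + θ * u


noncomputable def gg (d L u : ℝ) : ℂ :=
  Complex.exp (2 * (Real.pi : ℂ) * Complex.I * ((d * u * (1 + L - Real.log u) : ℝ) : ℂ)) / ((Real.sqrt u : ℝ) : ℂ)

lemma norm_ee (y : ℝ) : ‖Complex.exp (2 * (Real.pi : ℂ) * Complex.I * (y : ℂ))‖ = 1 := by
  have : 2 * (Real.pi : ℂ) * Complex.I * (y : ℂ) = ((2 * Real.pi * y : ℝ) : ℂ) * Complex.I := by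
    push_cast; ring
  rw [this, Complex.norm_exp_ofReal_mul_I]

lemma gg_norm (d L u : ℝ) : ‖gg d L u‖ = 1 / Real.sqrt u := by
  unfold gg
  rw [norm_div, norm_ee, Complex.norm_real, Real.norm_of_nonneg (Real.sqrt_nonneg u)]

lemma gg_cont (d L a b : ℝ) (ha : 0 < a) : ContinuousOn (gg d L) (Set.Icc a b) := by
  unfold gg
  have hne : ∀ x ∈ Set.Icc a b, x ≠ 0 := fun x hx => (lt_of_lt_of_le ha hx.1).ne'
  have h1 : ContinuousOn (fun u : ℝ => d * u * (1 + L - Real.log u)) (Set.Icc a b) := by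
    fun_prop (disch := assumption)
  apply ContinuousOn.div
  · have : ContinuousOn (fun u : ℝ => ((d * u * (1 + L - Real.log u) : ℝ) : ℂ)) (Set.Icc a b) :=
      Complex.continuous_ofReal.comp_continuousOn h1
    fun_prop
  · fun_prop
  · intro x hx
    have := Real.sqrt_pos.2 (lt_of_lt_of_le ha hx.1)
    exact_mod_cast this.ne'

lemma gg_int (d L a b : ℝ) (ha : 0 < a) (hab : a ≤ b) :
    IntervalIntegrable (gg d L) MeasureTheory.volume a b := by
  apply ContinuousOn.intervalIntegrable
  rw [Set.uIcc_of_le hab]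
  exact gg_cont d L a b ha

lemma firstDer (d L a b δ : ℝ) (hd : 0 < d) (ha : 0 < a) (hab : a ≤ b) (hδ : 0 < δ)
    (h1 : ∀ u ∈ Set.Icc a b, δ ≤ |L - Real.log u|)
    (h2 : ∀ u ∈ Set.Icc a b, L - Real.log u ≤ 2) :
    ‖∫ u in a..b, gg d L u‖ ≤ 1 / (d * Real.sqrt a * δ) := by
  set E : ℝ → ℂ := fun u => Complex.exp (2 * (Real.pi : ℂ) * Complex.I * ((d * u * (1 + L - Real.log u) : ℝ) : ℂ)) with hE
  set E' : ℝ → ℂ := fun u => E u * (2 * (Real.pi : ℂ) * Complex.I * ((d * (L - Real.log u) : ℝ) : ℂ)) with hE'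
  set ψ : ℝ → ℝ := fun u => Real.sqrt u * (L - Real.log u) with hψ
  set w : ℝ → ℝ := fun u => 1 / ψ u with hw
  set w' : ℝ → ℝ := fun u => (1 / Real.sqrt u * (1 - (L - Real.log u) / 2)) / (ψ u)^2 with hw'
  have hpos : ∀ u ∈ Set.Icc a b, 0 < u := fun u hu => lt_of_lt_of_le ha hu.1
  have hLne : ∀ u ∈ Set.Icc a b, L - Real.log u ≠ 0 := by
    intro u hu h
    have := h1 u hu
    rw [h, abs_zero] at this
    linarith
  have hψne : ∀ u ∈ Set.Icc a b, ψ u ≠ 0 := fun u hu =>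
    mul_ne_zero (Real.sqrt_pos.2 (hpos u hu)).ne' (hLne u hu)
  have hEd : ∀ u ∈ Set.Icc a b, HasDerivAt E (E' u) u := by
    intro u hu
    have hu0 := hpos u hu
    have e1 : HasDerivAt (fun u : ℝ => d * u * (1 + L - Real.log u)) (d * (L - Real.log u)) u := by
      have := ((hasDerivAt_id u).const_mul d).mul ((Real.hasDerivAt_log hu0.ne').const_sub (1 + L))
      refine this.congr_deriv ?_
      simp only [id, mul_one]; field_simp; ring
    exact (e1.ofReal_comp.const_mul (2 * (Real.pi : ℂ) * Complex.I)).cexp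
  have hwd : ∀ u ∈ Set.Icc a b, HasDerivAt w (w' u) u := by
    intro u hu
    have hu0 := hpos u hu
    have e1 := (Real.hasDerivAt_sqrt hu0.ne').mul ((Real.hasDerivAt_log hu0.ne').const_sub L)
    have e2 := e1.inv (hψne u hu)
    have hs := Real.sqrt_pos.2 hu0
    have hss := Real.sq_sqrt hu0.le
    have : w = (fun y => √y * (L - Real.log y))⁻¹ := by
      funext y; simp [hw, hψ]
    rw [this]
    refine e2.congr_deriv ?_
    simp only [hw', hψ]
    congr 1
    have : u⁻¹ = (Real.sqrt u)⁻¹ * (Real.sqrt u)⁻¹ := by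
      rw [← mul_inv, ← sq, hss]
    rw [this]; field_simp; ring
  have hcL : ContinuousOn (fun u : ℝ => L - Real.log u) (Set.Icc a b) := by
    have hne : ∀ x ∈ Set.Icc a b, x ≠ 0 := fun x hx => (hpos x hx).ne'
    fun_prop (disch := assumption)
  have hcE : ContinuousOn E (Set.Icc a b) := fun u hu => (hEd u hu).continuousAt.continuousWithinAt
  have hcw : ContinuousOn w (Set.Icc a b) := fun u hu => (hwd u hu).continuousAt.continuousWithinAt
  have hcE' : ContinuousOn E' (Set.Icc a b) := by
    apply hcE.mul
    have : ContinuousOn (fun u : ℝ => ((d * (L - Real.log u) : ℝ) : ℂ)) (Set.Icc a b) :=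
      Complex.continuous_ofReal.comp_continuousOn (continuousOn_const.mul hcL)
    exact continuousOn_const.mul this
  have hcψ : ContinuousOn ψ (Set.Icc a b) := Real.continuous_sqrt.continuousOn.mul hcL
  have hcw' : ContinuousOn w' (Set.Icc a b) := by
    apply ContinuousOn.div
    · apply ContinuousOn.mul
      · exact continuousOn_const.div Real.continuous_sqrt.continuousOn
          (fun u hu => (Real.sqrt_pos.2 (hpos u hu)).ne')
      · exact continuousOn_const.sub (hcL.div_const 2)
    · exact hcψ.pow 2
    · exact fun u hu => pow_ne_zero 2 (hψne u hu)
  have hIcc := Set.uIcc_of_le hab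
  have hcwc' : ContinuousOn (fun u => ((w' u : ℝ) : ℂ)) (Set.Icc a b) :=
    Complex.continuous_ofReal.comp_continuousOn hcw'
  have parts := intervalIntegral.integral_mul_deriv_eq_deriv_mul
    (u := fun u => ((w u : ℝ) : ℂ)) (v := E) (u' := fun u => ((w' u : ℝ) : ℂ)) (v' := E')
    (a := a) (b := b)
    (fun x hx => (hwd x (hIcc ▸ hx)).ofReal_comp) (fun x hx => hEd x (hIcc ▸ hx))
    (ContinuousOn.intervalIntegrable (hIcc.symm ▸ hcwc'))
    (ContinuousOn.intervalIntegrable (hIcc.symm ▸ hcE'))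
  have hW : ∀ u ∈ Set.Icc a b, |w u| ≤ 1 / (Real.sqrt a * δ) := by
    intro u hu
    simp only [hw, hψ]
    rw [abs_div, abs_one, abs_mul, abs_of_nonneg (Real.sqrt_nonneg u)]
    have := Real.sqrt_pos.2 ha
    apply one_div_le_one_div_of_le (by positivity)
    apply mul_le_mul (Real.sqrt_le_sqrt hu.1) (h1 u hu) hδ.le (Real.sqrt_nonneg _)
  have hw0 : ∀ u ∈ Set.Icc a b, 0 ≤ w' u := by
    intro u hu
    have := h2 u hu
    have h3 : 0 ≤ 1 - (L - Real.log u) / 2 := by linarith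
    simp only [hw']
    positivity
  have hnE : ∀ u, ‖E u‖ = 1 := fun u => norm_ee _
  have hint : ‖∫ u in a..b, ((w' u : ℝ) : ℂ) * E u‖ ≤ w b - w a := by
    calc _ ≤ ∫ u in a..b, w' u := by
          apply intervalIntegral.norm_integral_le_of_norm_le hab
          · refine Filter.Eventually.of_forall fun u hu => ?_
            have hu' : u ∈ Set.Icc a b := ⟨hu.1.le, hu.2⟩
            rw [norm_mul, hnE, mul_one, Complex.norm_real, Real.norm_of_nonneg (hw0 u hu')]
          · exact ContinuousOn.intervalIntegrable (hIcc.symm ▸ hcw')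
      _ = w b - w a := intervalIntegral.integral_eq_sub_of_hasDerivAt
          (fun x hx => hwd x (hIcc ▸ hx)) (ContinuousOn.intervalIntegrable (hIcc.symm ▸ hcw'))
  have hconv : ∫ u in a..b, gg d L u =
      (1 / (2 * (Real.pi : ℂ) * Complex.I * d)) * ∫ u in a..b, ((w u : ℝ) : ℂ) * E' u := by
    rw [← intervalIntegral.integral_const_mul]
    apply intervalIntegral.integral_congr
    intro u hu
    rw [hIcc] at hu
    have e1 : ((Real.sqrt u : ℝ) : ℂ) ≠ 0 := by exact_mod_cast (Real.sqrt_pos.2 (hpos u hu)).ne'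
    have e2 : ((L : ℂ) - (Real.log u : ℂ)) ≠ 0 := by exact_mod_cast hLne u hu
    have e3 : (d : ℂ) ≠ 0 := by exact_mod_cast hd.ne'
    have e4 : (Real.pi : ℂ) ≠ 0 := by exact_mod_cast Real.pi_pos.ne'
    have e5 := Complex.I_ne_zero
    simp only [gg, hw, hψ, hE', hE]
    set Z := Complex.exp (2 * (Real.pi : ℂ) * Complex.I * ((d * u * (1 + L - Real.log u) : ℝ) : ℂ))
    push_cast
    field_simp
  have ha' := Real.sqrt_pos.2 ha
  have hB : ‖∫ u in a..b, ((w u : ℝ) : ℂ) * E' u‖ ≤ 4 * (1 / (Real.sqrt a * δ)) := by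
    rw [parts]
    have A1 := abs_le.1 (hW a ⟨le_rfl, hab⟩)
    have A2 := abs_le.1 (hW b ⟨hab, le_rfl⟩)
    have n1 : ‖((w b : ℝ) : ℂ) * E b‖ ≤ 1 / (Real.sqrt a * δ) := by
      rw [norm_mul, hnE, mul_one, Complex.norm_real]; exact hW b ⟨hab, le_rfl⟩
    have n2 : ‖((w a : ℝ) : ℂ) * E a‖ ≤ 1 / (Real.sqrt a * δ) := by
      rw [norm_mul, hnE, mul_one, Complex.norm_real]; exact hW a ⟨le_rfl, hab⟩
    have n3 := norm_sub_le (((w b : ℝ) : ℂ) * E b - ((w a : ℝ) : ℂ) * E a) (∫ u in a..b, ((w' u : ℝ) : ℂ) * E u)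
    have n4 := norm_sub_le (((w b : ℝ) : ℂ) * E b) (((w a : ℝ) : ℂ) * E a)
    linarith
  rw [hconv, norm_mul]
  have hn : ‖(1 / (2 * (Real.pi : ℂ) * Complex.I * d))‖ = 1 / (2 * Real.pi * d) := by
    simp [abs_of_pos Real.pi_pos, abs_of_pos hd]
  rw [hn]
  calc _ ≤ 1 / (2 * Real.pi * d) * (4 * (1 / (Real.sqrt a * δ))) := by
        gcongr
    _ = (2 / Real.pi) * (1 / (d * Real.sqrt a * δ)) := by field_simp; ring
    _ ≤ 1 * (1 / (d * Real.sqrt a * δ)) := by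
        gcongr
        rw [div_le_one Real.pi_pos]; linarith [Real.pi_gt_three]
    _ = _ := one_mul _

lemma lemB (d L X a N : ℝ) (hd : 0 < d) (hX : 0 < X) (hL : L - Real.log X ≤ 2)
    (ha : Real.exp 3 * X ≤ a) (haN : a ≤ N) :
    ‖∫ u in a..N, gg d L u‖ ≤ 1 / (d * Real.sqrt X) := by
  have h3 : X ≤ Real.exp 3 * X := by
    have : (1:ℝ) ≤ Real.exp 3 := Real.one_le_exp (by norm_num)
    nlinarith
  have hlog : ∀ u ∈ Set.Icc a N, L - Real.log u ≤ -1 := by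
    intro u hu
    have : Real.log (Real.exp 3 * X) ≤ Real.log u :=
      Real.log_le_log (by positivity) (ha.trans hu.1)
    rw [Real.log_mul (by positivity) hX.ne', Real.log_exp] at this
    linarith
  have := firstDer d L a N 1 hd (by linarith) haN one_pos
    (fun u hu => by rw [abs_of_neg (by linarith [hlog u hu])]; linarith [hlog u hu])
    (fun u hu => by linarith [hlog u hu])
  refine this.trans ?_
  have := Real.sqrt_pos.2 hX
  rw [mul_one]
  gcongr
  linarith

lemma triv (d L X a b : ℝ) (hX : 0 < X) (ha : X ≤ a) (hab : a ≤ b) :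
    ‖∫ u in a..b, gg d L u‖ ≤ 1 / Real.sqrt X * (b - a) := by
  rw [← abs_of_nonneg (sub_nonneg.2 hab)]
  apply intervalIntegral.norm_integral_le_of_norm_le_const
  intro u hu
  rw [Set.uIoc_of_le hab] at hu
  rw [gg_norm]
  have := Real.sqrt_pos.2 hX
  gcongr
  linarith [hu.1]

lemma lemA (d L X N : ℝ) (hd : 0 < d) (hX : 1 ≤ X) (hL : L - Real.log X ≤ 2) (hXN : X ≤ N) :
    ‖∫ u in X..N, gg d L u‖ ≤ 2 / d + 3 * Real.exp 2 := by
  have hX0 : 0 < X := by linarith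
  have hs := Real.sqrt_pos.2 hX0
  have hs1 : 1 ≤ Real.sqrt X := by rw [Real.one_le_sqrt]; exact hX
  set δ := 1 / Real.sqrt X with hδ
  have hδ0 : 0 < δ := by positivity
  have hδ1 : δ ≤ 1 := by rw [hδ, div_le_one hs]; exact hs1
  set p1 := max X (min N (Real.exp (L - δ))) with hp1
  set p2 := max X (min N (Real.exp (L + δ))) with hp2
  have hX1 : X ≤ p1 := le_max_left _ _
  have h12 : p1 ≤ p2 := by
    apply max_le_max le_rfl
    apply min_le_min le_rfl
    apply Real.exp_le_exp.2; linarith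
  have h2N : p2 ≤ N := max_le hXN (min_le_left _ _)
  have hsplit : ∫ u in X..N, gg d L u = (∫ u in X..p1, gg d L u) + (∫ u in p1..p2, gg d L u)
      + ∫ u in p2..N, gg d L u := by
    rw [intervalIntegral.integral_add_adjacent_intervals, intervalIntegral.integral_add_adjacent_intervals]
    all_goals apply gg_int <;> linarith
  have hle2 : ∀ u, X ≤ u → L - Real.log u ≤ 2 := by
    intro u hu
    have := Real.log_le_log hX0 hu
    linarith
  have hdelta : ∀ c, X ≤ c → 1 / (d * Real.sqrt c * δ) ≤ 1 / d := by
    intro c hc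
    apply one_div_le_one_div_of_le hd
    have : Real.sqrt X ≤ Real.sqrt c := Real.sqrt_le_sqrt hc
    have h5 : 1 ≤ Real.sqrt c * δ := by
      rw [hδ, mul_one_div, le_div_iff₀ hs]; linarith
    nlinarith
  have b1 : ‖∫ u in X..p1, gg d L u‖ ≤ 1 / d := by
    rcases eq_or_lt_of_le hX1 with h | h
    · rw [← h]; simp; positivity
    · have hp : p1 ≤ Real.exp (L - δ) := by
        rcases max_cases X (min N (Real.exp (L - δ))) with h' | h'
        · rw [hp1] at h; linarith [h'.1]
        · rw [hp1, h'.1]; exact min_le_right _ _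
      refine (firstDer d L X p1 δ hd hX0 hX1 hδ0 ?_ (fun u hu => hle2 u hu.1)).trans (hdelta X le_rfl)
      intro u hu
      have : Real.log u ≤ L - δ := by
        rw [Real.log_le_iff_le_exp (by linarith [hu.1])]; exact hu.2.trans hp
      exact le_trans (by linarith) (le_abs_self _)
  have b3 : ‖∫ u in p2..N, gg d L u‖ ≤ 1 / d := by
    rcases eq_or_lt_of_le h2N with h | h
    · rw [h]; simp; positivity
    · have hp : Real.exp (L + δ) ≤ p2 := by
        rcases min_cases N (Real.exp (L + δ)) with h' | h'
        · have := le_max_right X (min N (Real.exp (L + δ)))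
          rw [h'.1] at this
          rw [hp2, h'.1] at h; linarith
        · rw [hp2, h'.1]; exact le_max_right _ _
      refine (firstDer d L p2 N δ hd (by linarith) h2N hδ0 ?_ (fun u hu => hle2 u (by linarith [hu.1]))).trans (hdelta p2 (by linarith))
      intro u hu
      have : L + δ ≤ Real.log u := by
        rw [Real.le_log_iff_exp_le (by linarith [hu.1])]; exact hp.trans hu.1
      exact le_trans (by linarith) (neg_le_abs _)
  have b2 : ‖∫ u in p1..p2, gg d L u‖ ≤ 3 * Real.exp 2 := by
    refine (triv d L X p1 p2 hX0 hX1 h12).trans ?_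
    have e0 : p2 - p1 ≤ Real.exp (L + δ) - Real.exp (L - δ) := by
      have : Real.exp (L - δ) ≤ Real.exp (L + δ) := Real.exp_le_exp.2 (by linarith)
      rw [hp1, hp2]
      rcases max_cases X (min N (Real.exp (L - δ))) with h | h <;>
      rcases max_cases X (min N (Real.exp (L + δ))) with h' | h' <;>
      rcases min_cases N (Real.exp (L - δ)) with h'' | h'' <;>
      rcases min_cases N (Real.exp (L + δ)) with h''' | h''' <;> linarith
    have e1 : Real.exp δ ≤ 1 + 2 * δ := by
      have := Real.abs_exp_sub_one_sub_id_le (x := δ) (by rw [abs_of_pos hδ0]; exact hδ1)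
      have := (abs_le.1 this).2
      nlinarith
    have e2 : 1 - δ ≤ Real.exp (-δ) := by linarith [Real.add_one_le_exp (-δ)]
    have e3 : Real.exp L ≤ Real.exp 2 * X := by
      have : Real.exp L ≤ Real.exp (2 + Real.log X) := Real.exp_le_exp.2 (by linarith)
      rwa [Real.exp_add, Real.exp_log hX0] at this
    have e4 : Real.exp (L + δ) - Real.exp (L - δ) ≤ Real.exp 2 * X * (3 * δ) := by
      rw [Real.exp_add, sub_eq_add_neg L, Real.exp_add, ← mul_sub]
      apply mul_le_mul e3 (by linarith) _ (by positivity)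
      have : Real.exp (-δ) ≤ Real.exp δ := Real.exp_le_exp.2 (by linarith)
      linarith
    calc 1 / Real.sqrt X * (p2 - p1) ≤ 1 / Real.sqrt X * (Real.exp 2 * X * (3 * δ)) := by
          gcongr; linarith
      _ = 3 * Real.exp 2 * (X / (Real.sqrt X) ^ 2) := by rw [hδ]; field_simp
      _ = 3 * Real.exp 2 := by rw [Real.sq_sqrt hX0.le, div_self hX0.ne', mul_one]
  rw [hsplit]
  refine (norm_add₃_le).trans ?_
  have : 2 / d = 1 / d + 1 / d := by ring
  linarith
noncomputable def TT (d L X Y : ℝ) : ℂ := ∫ u in X..Y, gg d L u / (2 * (Real.pi : ℂ) * Complex.I * d * u)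

lemma tt_int (d L X Y : ℝ) (hd : 0 < d) (hX : 0 < X) (hXY : X ≤ Y) :
    IntervalIntegrable (fun u : ℝ => gg d L u / (2 * (Real.pi : ℂ) * Complex.I * d * u)) MeasureTheory.volume X Y := by
  apply ContinuousOn.intervalIntegrable
  rw [Set.uIcc_of_le hXY]
  apply (gg_cont d L X Y hX).div (by fun_prop)
  intro u hu
  have e2 : (u : ℂ) ≠ 0 := by exact_mod_cast (lt_of_lt_of_le hX hu.1).ne'
  have e3 : (d : ℂ) ≠ 0 := by exact_mod_cast hd.ne'
  have e4 : (Real.pi : ℂ) ≠ 0 := by exact_mod_cast Real.pi_pos.ne'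
  have e5 := Complex.I_ne_zero
  simp [e2, e3, e4, e5]

lemma norm_den (d u : ℝ) (hd : 0 < d) (hu : 0 < u) :
    ‖(2 * (Real.pi : ℂ) * Complex.I * d * u)‖ = 2 * Real.pi * d * u := by
  simp [abs_of_pos Real.pi_pos, abs_of_pos hd, abs_of_pos hu]

lemma tt_bound (d L X Y K : ℝ) (hd : 0 < d) (hX : 0 < X) (hXY : X ≤ Y) (hY : Y ≤ K * X) :
    ‖TT d L X Y‖ ≤ K / (d * Real.sqrt X) := by
  have hs := Real.sqrt_pos.2 hX
  have : ‖TT d L X Y‖ ≤ 1 / (Real.sqrt X * (d * X)) * |Y - X| := by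
    apply intervalIntegral.norm_integral_le_of_norm_le_const
    intro u hu
    rw [Set.uIoc_of_le hXY] at hu
    have hu0 : 0 < u := by linarith [hu.1]
    rw [norm_div, gg_norm, norm_den d u hd hu0, div_div]
    have h1 : d * X ≤ 2 * Real.pi * d * u := by
      have : d * X ≤ d * u := by gcongr; exact hu.1.le
      have h2 : 1 ≤ 2 * Real.pi := by linarith [Real.pi_gt_three]
      nlinarith [mul_pos hd hu0]
    have h2 : Real.sqrt X ≤ Real.sqrt u := Real.sqrt_le_sqrt hu.1.le
    gcongr
  refine this.trans ?_
  rw [abs_of_nonneg (by linarith)]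
  calc _ ≤ 1 / (Real.sqrt X * (d * X)) * (K * X) := by gcongr; linarith
    _ = _ := by field_simp

lemma exp_second (y : ℝ) : ‖Complex.exp (y * Complex.I) - 1 - y * Complex.I‖ ≤ 3 * y ^ 2 := by
  have hn : ‖(y : ℂ) * Complex.I‖ = |y| := by simp
  rcases le_total |y| 1 with h | h
  · have := Complex.norm_exp_sub_one_sub_id_le (x := (y : ℂ) * Complex.I) (by rw [hn]; exact h)
    rw [hn, sq_abs] at this
    nlinarith [sq_nonneg y]
  · have h1 := norm_sub_le (Complex.exp (y * Complex.I) - 1) (y * Complex.I)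
    have h2 := norm_sub_le (Complex.exp (y * Complex.I)) 1
    rw [Complex.norm_exp_ofReal_mul_I, norm_one] at h2
    rw [hn] at h1
    have : y ^ 2 = |y| ^ 2 := (sq_abs y).symm
    rw [this]
    nlinarith

lemma pointwise (d L u : ℝ) (m : ℕ) (hm : 1 ≤ m) (hd : 0 < d) (hu : 0 < u) :
    ‖gg d L u / m - (gg d (L + (Real.log (m + 1) - Real.log m)) u / (2 * (Real.pi : ℂ) * Complex.I * d * u)
      - gg d L u / (2 * (Real.pi : ℂ) * Complex.I * d * u))‖
      ≤ 1 / Real.sqrt u * ((6 * Real.pi * d * u + 1) / m ^ 2) := by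
  set ε := Real.log (m + 1) - Real.log m with hε
  have hm0 : (0 : ℝ) < m := by exact_mod_cast hm
  have hε' : ε = Real.log ((m + 1) / m) := by rw [Real.log_div (by positivity) (by positivity)]
  have hε1 : ε ≤ 1 / m := by
    rw [hε']
    have := Real.log_le_sub_one_of_pos (x := ((m : ℝ) + 1) / m) (by positivity)
    refine this.trans (le_of_eq ?_)
    field_simp; ring
  have hε2 : 1 / m - 1 / (m : ℝ) ^ 2 ≤ ε := by
    rw [hε']
    have := Real.one_sub_inv_le_log_of_pos (x := ((m : ℝ) + 1) / m) (by positivity)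
    refine le_trans ?_ this
    rw [inv_div]
    have : 1 - (m : ℝ) / (m + 1) - (1 / m - 1 / (m : ℝ) ^ 2) = 1 / (m ^ 2 * (m + 1)) := by
      field_simp; ring
    have h2 : 0 ≤ 1 / ((m : ℝ) ^ 2 * (m + 1)) := by positivity
    linarith
  have hε0 : 0 ≤ ε := by
    rw [hε']; apply Real.log_nonneg; rw [le_div_iff₀ hm0]; linarith
  set t := 2 * Real.pi * d * u with ht
  have ht0 : 0 < t := by have := Real.pi_pos; positivity
  have htc : (2 * (Real.pi : ℂ) * Complex.I * d * u) = t * Complex.I := by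
    rw [ht]; push_cast; ring
  have hg : gg d (L + ε) u = gg d L u * Complex.exp ((t * ε : ℝ) * Complex.I) := by
    unfold gg
    rw [div_mul_eq_mul_div, ← Complex.exp_add]
    congr 2
    rw [ht]; push_cast; ring
  have htne : (t : ℂ) ≠ 0 := by exact_mod_cast ht0.ne'
  have hmne : (m : ℂ) ≠ 0 := by exact_mod_cast hm0.ne'
  have hI := Complex.I_ne_zero
  have key : gg d L u / m - (gg d (L + ε) u / (t * Complex.I) - gg d L u / (t * Complex.I))
      = gg d L u * (-((Complex.exp ((t * ε : ℝ) * Complex.I) - 1 - (t * ε : ℝ) * Complex.I)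
        + ((t * (ε - 1 / m) : ℝ) : ℂ) * Complex.I) / (t * Complex.I)) := by
    rw [hg]
    set Z := Complex.exp ((t * ε : ℝ) * Complex.I)
    push_cast
    field_simp
    ring
  rw [htc, key, norm_mul, gg_norm, norm_div, norm_neg]
  have hs := Real.sqrt_pos.2 hu
  have hnt : ‖(t : ℂ) * Complex.I‖ = t := by simp [abs_of_pos ht0]
  rw [hnt]
  apply mul_le_mul_of_nonneg_left _ (by positivity)
  rw [div_le_iff₀ ht0]
  have n1 := exp_second (t * ε)
  have n2 : ‖((t * (ε - 1 / m) : ℝ) : ℂ) * Complex.I‖ ≤ t * (1 / m ^ 2) := by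
    rw [norm_mul, Complex.norm_I, mul_one, Complex.norm_real, Real.norm_eq_abs, abs_mul, abs_of_pos ht0]
    gcongr
    rw [abs_le]; constructor <;> linarith [show (0:ℝ) ≤ 1 / (m : ℝ) ^ 2 by positivity]
  have n3 : 3 * (t * ε) ^ 2 ≤ 3 * (t * (1 / m)) ^ 2 := by gcongr
  refine (norm_add_le _ _).trans ?_
  have : (6 * Real.pi * d * u + 1) / (m : ℝ) ^ 2 * t = 3 * (t * (1 / m)) ^ 2 + t * (1 / m ^ 2) := by
    rw [show 6 * Real.pi * d * u = 3 * t by rw [ht]; ring]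
    field_simp
  linarith

lemma rr_bound (d L X Y K : ℝ) (m : ℕ) (hm : 1 ≤ m) (hd : 0 < d) (hX : 1 ≤ X) (hXY : X ≤ Y) (hY : Y ≤ K * X) :
    ‖(∫ u in X..Y, gg d L u) / m - (TT d (L + (Real.log (m + 1) - Real.log m)) X Y - TT d L X Y)‖
      ≤ K * (6 * Real.pi * d * K + 1) * (X * Real.sqrt X) / m ^ 2 := by
  have hX0 : 0 < X := by linarith
  have hs := Real.sqrt_pos.2 hX0
  have hpi := Real.pi_pos
  have hK : 0 < K := by
    by_contra h
    push Not at h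
    nlinarith
  unfold TT
  rw [← intervalIntegral.integral_div, ← intervalIntegral.integral_sub (tt_int _ _ _ _ hd hX0 hXY) (tt_int _ _ _ _ hd hX0 hXY),
    ← intervalIntegral.integral_sub ((gg_int _ _ _ _ hX0 hXY).div_const _)
      ((tt_int _ _ _ _ hd hX0 hXY).sub (tt_int _ _ _ _ hd hX0 hXY))]
  have := intervalIntegral.norm_integral_le_of_norm_le_const (a := X) (b := Y)
    (f := fun u : ℝ => gg d L u / m - (gg d (L + (Real.log (m + 1) - Real.log m)) u / (2 * (Real.pi : ℂ) * Complex.I * d * u)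
      - gg d L u / (2 * (Real.pi : ℂ) * Complex.I * d * u)))
    (C := 1 / Real.sqrt X * ((6 * Real.pi * d * (K * X) + X) / m ^ 2)) (by
      intro u hu
      rw [Set.uIoc_of_le hXY] at hu
      have hu0 : 0 < u := by linarith [hu.1]
      refine (pointwise d L u m hm hd hu0).trans ?_
      have h2 : Real.sqrt X ≤ Real.sqrt u := Real.sqrt_le_sqrt hu.1.le
      have h3 : u ≤ K * X := hu.2.trans hY
      gcongr)
  refine this.trans ?_
  have hm0 : (0 : ℝ) < m := by exact_mod_cast hm
  rw [abs_of_nonneg (by linarith)]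
  calc _ ≤ 1 / Real.sqrt X * ((6 * Real.pi * d * (K * X) + X) / m ^ 2) * (K * X) := by
        gcongr; linarith
    _ = K * (6 * Real.pi * d * K + 1) * (X * (X / Real.sqrt X)) / m ^ 2 := by field_simp
    _ = _ := by rw [Real.div_sqrt]

lemma tele (s : Finset ℕ) (hs : ∀ a ∈ s, ∀ b ∈ s, ∀ c, a ≤ c → c ≤ b → c ∈ s) (T : ℕ → ℂ) (B : ℝ) (hB0 : 0 ≤ B)
    (hB : ∀ m, ‖T m‖ ≤ B) : ‖∑ m ∈ s, (T (m + 1) - T m)‖ ≤ 2 * B := by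
  rcases s.eq_empty_or_nonempty with h | h
  · rw [h]; simp; exact hB0
  · have : s = Finset.Ico (s.min' h) (s.max' h + 1) := by
      ext c
      rw [Finset.mem_Ico]
      constructor
      · intro hc
        exact ⟨s.min'_le c hc, Nat.lt_succ_of_le (s.le_max' c hc)⟩
      · rintro ⟨h1, h2⟩
        exact hs _ (s.min'_mem h) _ (s.max'_mem h) c h1 (Nat.le_of_lt_succ h2)
    rw [this, Finset.sum_Ico_sub _ ((s.min'_le _ (s.max'_mem h)).trans (Nat.le_succ _))]
    refine (norm_sub_le _ _).trans ?_
    linarith [hB (s.max' h + 1), hB (s.min' h)]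

lemma card_bound (a b : ℝ) (hab : a ≤ b + 1) : ((Finset.Icc ⌈a⌉ ⌊b⌋).card : ℝ) ≤ b - a + 1 := by
  rw [Int.card_Icc]
  rcases le_total 0 (⌊b⌋ + 1 - ⌈a⌉) with h | h
  · have : (((⌊b⌋ + 1 - ⌈a⌉).toNat : ℤ) : ℝ) = ((⌊b⌋ + 1 - ⌈a⌉ : ℤ) : ℝ) := by
      rw [Int.toNat_of_nonneg h]
    rw [Int.cast_natCast] at this
    rw [this]; push_cast
    linarith [Int.floor_le b, Int.le_ceil a]
  · rw [Int.toNat_of_nonpos h]; simp; linarith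
noncomputable def LL (d θ : ℝ) (m : ℕ) (h : ℤ) : ℝ := Real.log m - Real.log d + (θ - h) / d

noncomputable def HH (d θ : ℝ) (X m : ℕ) : Finset ℤ :=
  Finset.Icc ⌈d * Real.log (m / (d * X)) + θ - 2 * d⌉ ⌊d * Real.log (m / (d * X)) + θ + d⌋

lemma conv (d θ : ℝ) (m : ℕ) (h : ℤ) (a b : ℝ) (hd : 0 < d) (hm : 1 ≤ m) (ha : 0 < a) (hab : a ≤ b) :
    (∫ x in a..b, Complex.exp (2 * (Real.pi : ℂ) * Complex.I *
      ((Fm d θ m x - (h : ℝ) * x : ℝ) : ℂ)) / ((Real.sqrt x : ℝ) : ℂ)) = ∫ x in a..b, gg d (LL d θ m h) x := by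
  apply intervalIntegral.integral_congr
  intro u hu
  rw [Set.uIcc_of_le hab] at hu
  have hu0 : 0 < u := lt_of_lt_of_le ha hu.1
  have hm0 : (0 : ℝ) < m := by exact_mod_cast hm
  have : Fm d θ m u - (h : ℝ) * u = d * u * (1 + LL d θ m h - Real.log u) := by
    unfold Fm LL
    rw [Real.log_div (by positivity) (by positivity), Real.log_mul (by positivity) hm0.ne',
      Real.log_mul hd.ne' hu0.ne', Real.log_exp]
    field_simp
    ring
  simp only [gg]
  rw [this]

lemma LL_le (d θ : ℝ) (X m : ℕ) (h : ℤ) (hd : 0 < d) (hX : 1 ≤ X) (hm : 1 ≤ m) (hh : h ∈ HH d θ X m) :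
    LL d θ m h - Real.log X ≤ 2 := by
  have hm0 : (0 : ℝ) < m := by exact_mod_cast hm
  have hX0 : (0 : ℝ) < X := by exact_mod_cast hX
  unfold HH at hh
  rw [Finset.mem_Icc] at hh
  have h1 := Int.ceil_le.1 hh.1
  rw [Real.log_div (by positivity) (by positivity), Real.log_mul hd.ne' hX0.ne'] at h1
  unfold LL
  have : Real.log m - Real.log d + (θ - h) / d - Real.log X
    = (d * (Real.log m - (Real.log d + Real.log X)) + θ - h) / d := by field_simp; ring
  rw [this, div_le_iff₀ hd]
  linarith

lemma HH_card (d θ : ℝ) (X m : ℕ) (hd : 0 < d) : ((HH d θ X m).card : ℝ) ≤ 3 * d + 1 := by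
  refine (card_bound _ _ (by linarith)).trans (by linarith)

lemma smain (d θ K Y : ℝ) (X M : ℕ) (hd : 0 < d) (hX : 1 ≤ X) (hXM : X ≤ M) (hXY : (X : ℝ) ≤ Y) (hY : Y ≤ K * X) :
    ‖∑ m ∈ Finset.Ioc X M, ∑ h ∈ HH d θ X m, (∫ u in (X : ℝ)..Y, gg d (LL d θ m h) u) / m‖ ≤
      (d * Real.log M + 3 * d + 1) * (2 * (K / (d * Real.sqrt X)))
      + (3 * d + 1) * (K * (6 * Real.pi * d * K + 1)) * Real.sqrt X := by
  have hX0 : (0 : ℝ) < X := by exact_mod_cast hX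
  have hX1 : (1 : ℝ) ≤ X := by exact_mod_cast hX
  have hs := Real.sqrt_pos.2 hX0
  have hpi := Real.pi_pos
  have hK : 0 < K := by
    by_contra h
    push Not at h
    nlinarith
  have hlog : ∀ m n : ℕ, X ≤ m → m ≤ n → Real.log (m / (d * X)) ≤ Real.log (n / (d * X)) := by
    intro m n h1 h2
    have hm0 : (0 : ℝ) < m := by exact_mod_cast (lt_of_lt_of_le hX h1)
    have : (m : ℝ) ≤ n := by exact_mod_cast h2
    apply Real.log_le_log (by positivity)
    gcongr
  set Hall : Finset ℤ := Finset.Icc ⌈d * Real.log (X / (d * X)) + θ - 2 * d⌉ ⌊d * Real.log (M / (d * X)) + θ + d⌋ with hHall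
  have hcard : (Hall.card : ℝ) ≤ d * Real.log M + 3 * d + 1 := by
    have hM0 : (0 : ℝ) < M := by exact_mod_cast (lt_of_lt_of_le hX hXM)
    have h0 := mul_le_mul_of_nonneg_left (hlog X M le_rfl hXM) hd.le
    refine (card_bound _ _ (by linarith)).trans ?_
    rw [Real.log_div (by positivity) (by positivity), Real.log_div (by positivity) (by positivity)]
    have := mul_nonneg hd.le (Real.log_nonneg hX1)
    linarith
  have hsplit : ∑ m ∈ Finset.Ioc X M, ∑ h ∈ HH d θ X m, (∫ u in (X : ℝ)..Y, gg d (LL d θ m h) u) / (m : ℂ)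
      = (∑ m ∈ Finset.Ioc X M, ∑ h ∈ HH d θ X m, (TT d (LL d θ (m + 1) h) X Y - TT d (LL d θ m h) X Y))
      + ∑ m ∈ Finset.Ioc X M, ∑ h ∈ HH d θ X m, ((∫ u in (X : ℝ)..Y, gg d (LL d θ m h) u) / (m : ℂ)
        - (TT d (LL d θ (m + 1) h) X Y - TT d (LL d θ m h) X Y)) := by
    simp_rw [← Finset.sum_add_distrib]
    apply Finset.sum_congr rfl; intro m _
    apply Finset.sum_congr rfl; intro h _
    ring
  rw [hsplit]
  refine (norm_add_le _ _).trans (add_le_add ?_ ?_)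
  · rw [Finset.sum_comm' (t' := Hall) (s' := fun h => (Finset.Ioc X M).filter (fun m => h ∈ HH d θ X m))]
    · calc _ ≤ ∑ h ∈ Hall, 2 * (K / (d * Real.sqrt X)) := by
            apply norm_sum_le_of_le
            intro h _
            apply tele _ _ (fun m => TT d (LL d θ m h) X Y) _ (by positivity)
            · intro m; exact tt_bound _ _ _ _ _ hd hX0 hXY hY
            · intro a ha b hb c hac hcb
              simp only [HH, Finset.mem_filter, Finset.mem_Ioc, Finset.mem_Icc, Int.ceil_le, Int.le_floor] at ha hb ⊢
              have e1 := mul_le_mul_of_nonneg_left (hlog a c (by omega) hac) hd.le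
              have e2 := mul_le_mul_of_nonneg_left (hlog c b (by omega) hcb) hd.le
              exact ⟨by omega, by linarith, by linarith⟩
        _ = Hall.card * (2 * (K / (d * Real.sqrt X))) := by simp
        _ ≤ _ := by gcongr
    · intro m h
      simp only [Finset.mem_filter]
      constructor
      · rintro ⟨h1, h2⟩
        refine ⟨⟨h1, h2⟩, ?_⟩
        simp only [hHall, HH, Finset.mem_Ioc, Finset.mem_Icc, Int.ceil_le, Int.le_floor] at h1 h2 ⊢
        have e1 := mul_le_mul_of_nonneg_left (hlog X m le_rfl h1.1.le) hd.le
        have e2 := mul_le_mul_of_nonneg_left (hlog m M h1.1.le h1.2) hd.le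
        exact ⟨by linarith, by linarith⟩
      · rintro ⟨⟨h1, h2⟩, _⟩
        exact ⟨h1, h2⟩
  · set R := K * (6 * Real.pi * d * K + 1) with hR
    have hR0 : 0 < R := by positivity
    calc _ ≤ ∑ m ∈ Finset.Ioc X M, (3 * d + 1) * (R * (X * Real.sqrt X)) * ((m : ℝ) ^ 2)⁻¹ := by
          apply norm_sum_le_of_le
          intro m hm
          rw [Finset.mem_Ioc] at hm
          have hm1 : 1 ≤ m := by omega
          calc _ ≤ ∑ h ∈ HH d θ X m, R * (X * Real.sqrt X) / (m : ℝ) ^ 2 := by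
                apply norm_sum_le_of_le
                intro h _
                have : LL d θ (m + 1) h = LL d θ m h + (Real.log (m + 1) - Real.log m) := by
                  unfold LL; push_cast; ring
                rw [this]
                exact rr_bound d (LL d θ m h) X Y K m hm1 hd hX1 hXY hY
            _ = (HH d θ X m).card * (R * (X * Real.sqrt X) / (m : ℝ) ^ 2) := by simp
            _ ≤ (3 * d + 1) * (R * (X * Real.sqrt X) / (m : ℝ) ^ 2) := by
                gcongr
                exact HH_card d θ X m hd
            _ = _ := by rw [div_eq_mul_inv]; ring
      _ = (3 * d + 1) * (R * (X * Real.sqrt X)) * ∑ m ∈ Finset.Ioc X M, ((m : ℝ) ^ 2)⁻¹ := by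
          rw [Finset.mul_sum]
      _ ≤ (3 * d + 1) * (R * (X * Real.sqrt X)) * (X : ℝ)⁻¹ := by
          gcongr
          refine (sum_Ioc_inv_sq_le_sub (by omega) hXM).trans ?_
          have : (0 : ℝ) ≤ (M : ℝ)⁻¹ := by positivity
          linarith
      _ = _ := by field_simp

lemma sum_inv_le (X : ℕ) : ∑ m ∈ Finset.Icc 1 X, 1 / (m : ℝ) ≤ 1 + Real.log X := by
  have := harmonic_le_one_add_log X
  rw [harmonic_eq_sum_Icc] at this
  push_cast at this
  simpa using this

/-- generic absolute bound -/
lemma absb (d θ B : ℝ) (X : ℕ) (hd : 0 < d) (hB : 0 ≤ B) (s : Finset ℕ) (c : ℕ → ℝ) (hc : ∀ m ∈ s, 0 ≤ c m)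
    (J : ℕ → ℤ → ℂ) (hJ : ∀ m ∈ s, ∀ h ∈ HH d θ X m, ‖J m h‖ ≤ B) :
    ‖∑ m ∈ s, (c m : ℂ) * ∑ h ∈ HH d θ X m, J m h‖ ≤ (3 * d + 1) * B * ∑ m ∈ s, c m := by
  rw [Finset.mul_sum]
  apply norm_sum_le_of_le
  intro m hm
  rw [norm_mul, Complex.norm_real, Real.norm_of_nonneg (hc m hm), mul_comm]
  apply mul_le_mul_of_nonneg_right _ (hc m hm)
  calc _ ≤ ∑ h ∈ HH d θ X m, B := norm_sum_le_of_le _ (hJ m hm)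
    _ = (HH d θ X m).card * B := by simp
    _ ≤ _ := by gcongr; exact HH_card d θ X m hd

set_option maxHeartbeats 2000000 in
theorem statement18 (σ d θ : ℝ) (hσ : σ ≤ 0) (hd : 0 < d)
    (C1 C2 : ℝ) (hC1 : 1 < C1) (hC12 : C1 < C2) :
    ∃ C > (0 : ℝ), ∀ N M : ℕ, 2 ≤ N → 2 ≤ M → C1 * N ≤ M → (M : ℝ) ≤ C2 * N →
      ∀ X : ℕ, 2 ≤ X → X ≤ M → X ≤ N →
        ‖∑ m ∈ Finset.Icc 1 M, (1 / ((((m : ℝ) ^ (1 - σ) : ℝ)) : ℂ)) *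
            ∑ h ∈ Finset.Icc ⌈d * Real.log (m / (d * X)) + θ - 2 * d⌉
                ⌊d * Real.log (m / (d * X)) + θ + d⌋,
              ∫ x in (X : ℝ)..(N : ℝ),
                Complex.exp (2 * (Real.pi : ℂ) * Complex.I *
                    ((Fm d θ m x - (h : ℝ) * x : ℝ) : ℂ)) / ((Real.sqrt x : ℝ) : ℂ)‖
          ≤ C * (if σ = 0 then Real.sqrt X * Real.log X + Real.log N / Real.sqrt X
              else 1) := by
  set CA := 2 / d + 3 * Real.exp 2 with hCA
  have hCA0 : 0 < CA := by positivity
  have hpi := Real.pi_pos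
  have hrw : ∀ N M X : ℕ, 2 ≤ X → X ≤ N → (∑ m ∈ Finset.Icc 1 M, (1 / ((((m : ℝ) ^ (1 - σ) : ℝ)) : ℂ)) *
            ∑ h ∈ Finset.Icc ⌈d * Real.log (m / (d * X)) + θ - 2 * d⌉
                ⌊d * Real.log (m / (d * X)) + θ + d⌋,
              ∫ x in (X : ℝ)..(N : ℝ),
                Complex.exp (2 * (Real.pi : ℂ) * Complex.I *
                    ((Fm d θ m x - (h : ℝ) * x : ℝ) : ℂ)) / ((Real.sqrt x : ℝ) : ℂ))
      = ∑ m ∈ Finset.Icc 1 M, ((1 / (m : ℝ) ^ (1 - σ) : ℝ) : ℂ) * ∑ h ∈ HH d θ X m,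
          ∫ x in (X : ℝ)..(N : ℝ), gg d (LL d θ m h) x := by
    intro N M X hX hXN
    apply Finset.sum_congr rfl
    intro m hm
    rw [Finset.mem_Icc] at hm
    congr 1
    · push_cast; rfl
    · unfold HH
      apply Finset.sum_congr rfl
      intro h _
      exact conv d θ m h X N hd hm.1 (by exact_mod_cast (by omega : 0 < X)) (by exact_mod_cast hXN)
  have hA : ∀ N X m : ℕ, 2 ≤ X → X ≤ N → 1 ≤ m → ∀ h ∈ HH d θ X m,
      ‖∫ x in (X : ℝ)..(N : ℝ), gg d (LL d θ m h) x‖ ≤ CA := by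
    intro N X m hX hXN hm h hh
    exact lemA d _ X N hd (by exact_mod_cast (by omega : 1 ≤ X)) (LL_le d θ X m h hd (by omega) hm hh)
      (by exact_mod_cast hXN)
  by_cases h0 : σ = 0
  · subst h0
    set K := Real.exp 3 with hK
    have hK1 : 1 ≤ K := Real.one_le_exp (by norm_num)
    set R := K * (6 * Real.pi * d * K + 1) with hR
    have hR0 : 0 < R := by positivity
    have hl2 : 0 < Real.log 2 := Real.log_pos (by norm_num)
    have hlC2 : 0 < Real.log C2 := Real.log_pos (by linarith)
    set κ := 1 / Real.log 2 with hκ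
    have hκ0 : 0 < κ := by positivity
    set A1 := (3 * d + 1) * CA * (κ + 1) + (3 * d + 1) * R * κ with hA1
    set μ := κ * Real.log C2 + 1 with hμ
    set A2 := (3 * d + 1) * (1 / d) * (κ + μ) + (d * μ + (3 * d + 1) * κ) * (2 * (K / d)) with hA2
    have hA10 : 0 < A1 := by positivity
    have hA20 : 0 < A2 := by positivity
    refine ⟨A1 + A2, by positivity, ?_⟩
    intro N M hN hM h1 h2 X hX hXM hXN
    rw [hrw N M X hX hXN, if_pos rfl]
    have hX0 : (0 : ℝ) < X := by exact_mod_cast (by omega : 0 < X)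
    have hX1 : (1 : ℝ) ≤ X := by exact_mod_cast (by omega : 1 ≤ X)
    have hN0 : (0 : ℝ) < N := by exact_mod_cast (by omega : 0 < N)
    have hXN' : (X : ℝ) ≤ N := by exact_mod_cast hXN
    have hs := Real.sqrt_pos.2 hX0
    have hs1 : 1 ≤ Real.sqrt X := by rw [Real.one_le_sqrt]; exact hX1
    have hlX : Real.log 2 ≤ Real.log X := Real.log_le_log (by norm_num) (by exact_mod_cast hX)
    have hlN : Real.log 2 ≤ Real.log N := Real.log_le_log (by norm_num) (by exact_mod_cast hN)
    have hoX : 1 ≤ κ * Real.log X := by rw [hκ, one_div_mul_eq_div, le_div_iff₀ hl2]; linarith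
    have hoN : 1 ≤ κ * Real.log N := by rw [hκ, one_div_mul_eq_div, le_div_iff₀ hl2]; linarith
    have hlM : Real.log M ≤ μ * Real.log N := by
      have : Real.log M ≤ Real.log (C2 * N) :=
        Real.log_le_log (by exact_mod_cast (by omega : 0 < M)) h2
      rw [Real.log_mul (by linarith) hN0.ne'] at this
      rw [hμ]
      nlinarith
    set Y : ℝ := min (K * X) N with hY
    have hXY : (X : ℝ) ≤ Y := le_min (by nlinarith) hXN'
    have hYK : Y ≤ K * X := min_le_left _ _
    have hYN : Y ≤ N := min_le_right _ _
    have hunion : Finset.Icc 1 M = Finset.Icc 1 X ∪ Finset.Ioc X M := by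
      ext a; simp only [Finset.mem_union, Finset.mem_Icc, Finset.mem_Ioc]; omega
    have hdisj : Disjoint (Finset.Icc 1 X) (Finset.Ioc X M) := by
      rw [Finset.disjoint_left]; intro a; simp only [Finset.mem_Icc, Finset.mem_Ioc]; omega
    have hsplit : ∑ m ∈ Finset.Icc 1 M, ((1 / (m : ℝ) ^ (1 - (0:ℝ)) : ℝ) : ℂ) * ∑ h ∈ HH d θ X m,
          ∫ x in (X : ℝ)..(N : ℝ), gg d (LL d θ m h) x
        = (∑ m ∈ Finset.Icc 1 X, ((1 / (m : ℝ) : ℝ) : ℂ) * ∑ h ∈ HH d θ X m,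
          ∫ x in (X : ℝ)..(N : ℝ), gg d (LL d θ m h) x)
        + (∑ m ∈ Finset.Ioc X M, ∑ h ∈ HH d θ X m, (∫ u in (X : ℝ)..Y, gg d (LL d θ m h) u) / m)
        + (∑ m ∈ Finset.Ioc X M, ((1 / (m : ℝ) : ℝ) : ℂ) * ∑ h ∈ HH d θ X m,
          ∫ x in Y..(N : ℝ), gg d (LL d θ m h) x) := by
      simp only [sub_zero, Real.rpow_one]
      rw [hunion, Finset.sum_union hdisj, add_assoc, ← Finset.sum_add_distrib]
      congr 1
      apply Finset.sum_congr rfl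
      intro m _
      simp_rw [Finset.mul_sum]
      rw [← Finset.sum_add_distrib]
      apply Finset.sum_congr rfl
      intro h _
      rw [← intervalIntegral.integral_add_adjacent_intervals (gg_int d (LL d θ m h) X Y hX0 hXY)
        (gg_int d (LL d θ m h) Y N (by linarith) hYN)]
      push_cast
      ring
    have p1 := absb d θ CA X hd hCA0.le (Finset.Icc 1 X) (fun m => 1 / (m : ℝ)) (fun m _ => by positivity)
      (fun m h => ∫ x in (X : ℝ)..(N : ℝ), gg d (LL d θ m h) x)
      (fun m hm h hh => hA N X m hX hXN (Finset.mem_Icc.1 hm).1 h hh)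
    have p2 := smain d θ K Y X M hd (by omega) hXM hXY hYK
    have p3 := absb d θ (1 / (d * Real.sqrt X)) X hd (by positivity) (Finset.Ioc X M) (fun m => 1 / (m : ℝ))
      (fun m _ => by positivity)
      (fun m h => ∫ x in Y..(N : ℝ), gg d (LL d θ m h) x)
      (fun m hm h hh => by
        rcases le_total (K * X) (N : ℝ) with hc | hc
        · exact lemB d _ X Y N hd hX0 (LL_le d θ X m h hd (by omega) (by rw [Finset.mem_Ioc] at hm; omega) hh)
            (by rw [hY, min_eq_left hc]) hYN
        · rw [hY, min_eq_right hc]; simp; positivity)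
    have q1 := sum_inv_le X
    have q3 : ∑ m ∈ Finset.Ioc X M, 1 / (m : ℝ) ≤ 1 + Real.log M := by
      refine le_trans ?_ (sum_inv_le M)
      apply Finset.sum_le_sum_of_subset_of_nonneg
      · rw [hunion]; exact Finset.subset_union_right
      · intro m _ _; positivity
    rw [hsplit]
    refine norm_add₃_le.trans ?_
    have r1 : (3 * d + 1) * CA * ∑ m ∈ Finset.Icc 1 X, 1 / (m : ℝ)
        ≤ (3 * d + 1) * CA * (κ + 1) * (Real.sqrt X * Real.log X) := by
      have : 1 + Real.log X ≤ (κ + 1) * (Real.sqrt X * Real.log X) := by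
        have : (κ + 1) * Real.log X ≤ (κ + 1) * (Real.sqrt X * Real.log X) := by
          gcongr; nlinarith
        linarith
      rw [mul_assoc ((3 * d + 1) * CA)]
      gcongr
      linarith
    have r2 : (3 * d + 1) * R * Real.sqrt X ≤ (3 * d + 1) * R * κ * (Real.sqrt X * Real.log X) := by
      have : (3 * d + 1) * R * Real.sqrt X * 1 ≤ (3 * d + 1) * R * Real.sqrt X * (κ * Real.log X) := by gcongr
      linarith
    have r3 : (3 * d + 1) * (1 / (d * Real.sqrt X)) * ∑ m ∈ Finset.Ioc X M, 1 / (m : ℝ)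
        ≤ (3 * d + 1) * (1 / d) * (κ + μ) * (Real.log N / Real.sqrt X) := by
      calc _ ≤ (3 * d + 1) * (1 / (d * Real.sqrt X)) * ((κ + μ) * Real.log N) := by
            gcongr; linarith
        _ = _ := by field_simp
    have r4 : (d * Real.log M + 3 * d + 1) * (2 * (K / (d * Real.sqrt X)))
        ≤ (d * μ + (3 * d + 1) * κ) * (2 * (K / d)) * (Real.log N / Real.sqrt X) := by
      have : d * Real.log M + 3 * d + 1 ≤ (d * μ + (3 * d + 1) * κ) * Real.log N := by
        have a1 := mul_le_mul_of_nonneg_left hlM hd.le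
        have a2 := mul_le_mul_of_nonneg_left hoN (by positivity : 0 ≤ 3 * d + 1)
        linarith
      calc _ ≤ ((d * μ + (3 * d + 1) * κ) * Real.log N) * (2 * (K / (d * Real.sqrt X))) := by
            gcongr
        _ = _ := by field_simp
    have z1 : 0 ≤ Real.sqrt X * Real.log X := mul_nonneg hs.le (by linarith)
    have z2 : 0 ≤ Real.log N / Real.sqrt X := div_nonneg (by linarith) hs.le
    have z3 := mul_nonneg hA10.le z2
    have z4 := mul_nonneg hA20.le z1
    have e1 : (A1 + A2) * (Real.sqrt X * Real.log X + Real.log N / Real.sqrt X)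
      = A1 * (Real.sqrt X * Real.log X) + A2 * (Real.log N / Real.sqrt X)
        + A1 * (Real.log N / Real.sqrt X) + A2 * (Real.sqrt X * Real.log X) := by ring
    have e2 : A1 * (Real.sqrt X * Real.log X) = (3 * d + 1) * CA * (κ + 1) * (Real.sqrt X * Real.log X)
      + (3 * d + 1) * R * κ * (Real.sqrt X * Real.log X) := by rw [hA1]; ring
    have e3 : A2 * (Real.log N / Real.sqrt X) = (3 * d + 1) * (1 / d) * (κ + μ) * (Real.log N / Real.sqrt X)
      + (d * μ + (3 * d + 1) * κ) * (2 * (K / d)) * (Real.log N / Real.sqrt X) := by rw [hA2]; ring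
    linarith
  · have hsum : Summable (fun n : ℕ => 1 / (n : ℝ) ^ (1 - σ)) := by
      rw [Real.summable_one_div_nat_rpow]
      have : σ < 0 := lt_of_le_of_ne hσ h0
      linarith
    set S := ∑' n : ℕ, 1 / (n : ℝ) ^ (1 - σ) with hS
    have hS0 : 0 ≤ S := tsum_nonneg (fun n => by positivity)
    refine ⟨(3 * d + 1) * CA * (S + 1), by positivity, ?_⟩
    intro N M hN hM h1 h2 X hX hXM hXN
    rw [hrw N M X hX hXN, if_neg h0, mul_one]
    refine (absb d θ CA X hd hCA0.le (Finset.Icc 1 M) (fun m => 1 / (m : ℝ) ^ (1 - σ)) (fun m _ => by positivity)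
      (fun m h => ∫ x in (X : ℝ)..(N : ℝ), gg d (LL d θ m h) x)
      (fun m hm h hh => hA N X m hX hXN (Finset.mem_Icc.1 hm).1 h hh)).trans ?_
    gcongr
    have := hsum.sum_le_tsum (Finset.Icc 1 M) (fun n _ => by positivity)
    linarith
end

section
/- Let σ ≤ 0, d > 0, and θ be fixed real numbers, and fix constants C_2 > C_1 > 1. Let N, M be positive integers with C_1·N ≤ M ≤ C_2·N, let V be a real number with N^{−1/2} ≤ V ≤ 1/4, and let X be an integer with 3 ≤ X ≤ min(M, N) which is sufficiently large in terms of absolute constants. For a positive integer m set H_1''(m) = d·log(m/(d(1−V)N)) + θ, H_2(m) = d·log(m/(dX)) + θ, and f_{m,h}(u) = F_m(u) − h·u. Then Σ_{m=1}^M (1/m^{1−σ}) Σ_{h ∈ ℤ, H_1''(m) ≤ h < H_2(m)−2d} ∫_X^N e^{2πi f_{m,h}(u)}/u^{1/2} du = (e^{−2πi/8}/d^{1/2})·Σ_{m=1}^M (1/m^{1−σ}) Σ_{h ∈ ℤ, H_1''(m) ≤ h < H_2(m)−2d} e^{2πi·m·e^{(θ−h)/d}} + O((1 + 𝟙(σ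 = 0)·log N)·(log log N / X^{1/2} + 1/(X^{1/2}·V) + 1/(X^{3/2}·V^3))), where the implied constant depends only on σ, d, θ, C_1, C_2. -/
open Filter Topology MeasureTheory

lemma an_dslope {f : ℝ → ℝ} (hf : ∀ y, AnalyticAt ℝ f y) (y : ℝ) : AnalyticAt ℝ (dslope f 0) y := by
  by_cases h : y = 0
  · subst h
    obtain ⟨p, hp⟩ := hf 0
    exact ⟨_, hp.has_fpower_series_dslope_fslope⟩
  · have h1 : AnalyticAt ℝ (fun z => (f z - f 0) / z) y :=
      ((hf y).sub analyticAt_const).div analyticAt_id h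
    refine h1.congr ?_
    filter_upwards [dslope_eventuallyEq_slope_of_ne f h] with z hz
    rw [hz, slope_def_field]; simp

lemma E_deriv (y : ℝ) : HasDerivAt (fun y : ℝ => 1 + (y - 1) * Real.exp y) (y * Real.exp y) y := by
  have := (((hasDerivAt_id y).sub_const 1).mul (Real.hasDerivAt_exp y)).const_add 1
  exact this.congr_deriv (by simp; ring)

lemma E_pos {y : ℝ} (hy : y ≠ 0) : 0 < 1 + (y - 1) * Real.exp y := by
  have h := Real.add_one_lt_exp (x := -y) (by simpa using hy)
  have h2 := Real.exp_pos y
  have h3 : Real.exp y * Real.exp (-y) = 1 := by rw [← Real.exp_add]; simp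
  nlinarith

lemma exists_RK : ∃ R K : ℝ → ℝ, (∀ y, AnalyticAt ℝ R y) ∧ (∀ y, AnalyticAt ℝ K y) ∧
    (∀ y, 0 < R y) ∧ (∀ y, y ^ 2 * R y ^ 2 = 1 + (y - 1) * Real.exp y) ∧
    (∀ y, y * K y = Real.exp (-y / 2) - 1 / (Real.sqrt 2 * R y)) ∧
    (∀ y, HasDerivAt (fun y => y * R y) (Real.exp y / (2 * R y)) y) := by
  set E : ℝ → ℝ := fun y => 1 + (y - 1) * Real.exp y with hE
  have hEa : ∀ y, AnalyticAt ℝ E y := by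
    intro y
    have : AnalyticAt ℝ (fun y : ℝ => Real.exp y) y := analyticAt_rexp
    simp only [hE]
    fun_prop
  set D := dslope E 0 with hD
  have hDa : ∀ y, AnalyticAt ℝ D y := an_dslope hEa
  have hD0 : D 0 = 0 := by rw [hD, dslope_same, (E_deriv 0).deriv]; simp
  have hDE : ∀ y, y * D y = E y := by
    intro y
    have := sub_smul_dslope E 0 y
    simp [hE] at this
    simpa [hE, hD] using this
  set q := dslope D 0 with hq
  have hqa : ∀ y, AnalyticAt ℝ q y := an_dslope hDa
  have hqD : ∀ y, y * q y = D y := by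
    intro y
    have := sub_smul_dslope D 0 y
    simpa [hD0] using this
  have hqE : ∀ y, y ^ 2 * q y = E y := by
    intro y; rw [← hDE, ← hqD]; ring
  have hqd : ∀ y, HasDerivAt q (deriv q y) y := fun y => (hqa y).differentiableAt.hasDerivAt
  have hode : (fun y => 2 * q y + y * deriv q y) = fun y => Real.exp y := by
    apply Continuous.ext_on (dense_compl_singleton (0:ℝ))
    · have h1 : Continuous q := continuous_iff_continuousAt.mpr fun y => (hqa y).continuousAt
      have h2 : Continuous (deriv q) := continuous_iff_continuousAt.mpr fun y => (hqa y).deriv.continuousAt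
      fun_prop
    · fun_prop
    · intro y hy
      have hy : y ≠ 0 := hy
      have h1 := ((hasDerivAt_id y).pow 2).mul (hqd y)
      have h2 : HasDerivAt E (2 * y * q y + y ^ 2 * deriv q y) y := by
        have h3 : E = id ^ 2 * q := by ext z; simp [← hqE]
        rw [h3]
        exact h1.congr_deriv (by simp)
      have := h2.unique (E_deriv y)
      simp only
      apply mul_left_cancel₀ hy
      rw [← this]; ring
  have hode' := fun y => congrFun hode y
  have hqpos : ∀ y, 0 < q y := by
    intro y
    by_cases h : y = 0
    · subst h; have := hode' 0; simp at this; linarith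
    · have h1 := E_pos h
      have h2 := hqE y
      simp only [hE] at h2
      rw [← h2] at h1
      exact pos_of_mul_pos_right h1 (sq_nonneg y)
  have hq0 : q 0 = 1 / 2 := by have := hode' 0; simp at this; linarith
  set R : ℝ → ℝ := fun y => Real.exp (Real.log (q y) / 2) with hR
  have hRa : ∀ y, AnalyticAt ℝ R y := by
    intro y
    have h1 : AnalyticAt ℝ (fun y => Real.log (q y) / 2) y := ((hqa y).log (hqpos y)).div analyticAt_const (by norm_num)
    exact h1.rexp
  have hRp : ∀ y, 0 < R y := fun y => Real.exp_pos _
  have hR2 : ∀ y, R y ^ 2 = q y := by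
    intro y
    rw [hR]; simp only
    rw [← Real.exp_nat_mul]; push_cast
    rw [mul_div_cancel₀ _ (by norm_num), Real.exp_log (hqpos y)]
  set P : ℝ → ℝ := fun y => Real.exp (-y / 2) - 1 / (Real.sqrt 2 * R y) with hP
  have hPa : ∀ y, AnalyticAt ℝ P y := by
    intro y
    have h1 : AnalyticAt ℝ (fun y : ℝ => Real.exp (-y / 2)) y := by
      have : AnalyticAt ℝ (fun y : ℝ => -y / 2) y := by fun_prop (disch := norm_num)
      exact this.rexp
    exact h1.sub (analyticAt_const.div (analyticAt_const.mul (hRa y)) (by have := hRp y; positivity))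
  have hP0 : P 0 = 0 := by
    have h1 : Real.sqrt 2 * R 0 = 1 := by
      have h2 : (Real.sqrt 2 * R 0) ^ 2 = 1 := by
        rw [mul_pow, hR2, hq0]; norm_num
      have h3 : 0 ≤ Real.sqrt 2 * R 0 := by have := hRp 0; positivity
      nlinarith
    simp only [hP, h1]; simp
  refine ⟨R, dslope P 0, hRa, an_dslope hPa, hRp, ?_, ?_, ?_⟩
  · intro y; rw [hR2, hqE]
  · intro y
    have := sub_smul_dslope P 0 y
    simp only [hP0, sub_zero, smul_eq_mul] at this
    exact this
  · intro y
    have hRd : HasDerivAt R (deriv R y) y := (hRa y).differentiableAt.hasDerivAt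
    have h1 := hRd.pow 2
    have h2 : HasDerivAt q (2 * R y * deriv R y) y := by
      have h3 : q = R ^ 2 := by ext z; simp [← hR2]
      rw [h3]
      exact h1.congr_deriv (by simp)
    have h3 := h2.deriv
    have h4 := hode' y
    rw [h3, ← hR2] at h4
    have h5 := (hasDerivAt_id y).mul hRd
    have := hRp y
    refine h5.congr_deriv ?_
    rw [← h4]; simp; field_simp

lemma E_low {B : ℝ} (hB : 0 ≤ B) : B ^ 2 / 2 ≤ 1 + (B - 1) * Real.exp B := by
  have hd : ∀ y : ℝ, HasDerivAt (fun y : ℝ => (1 + (y - 1) * Real.exp y) - y ^ 2 / 2)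
      (y * Real.exp y - y) y := by
    intro y
    exact ((E_deriv y).sub (((hasDerivAt_id y).pow 2).div_const 2)).congr_deriv (by simp)
  have hm : MonotoneOn (fun y : ℝ => (1 + (y - 1) * Real.exp y) - y ^ 2 / 2) (Set.Ici 0) := by
    apply monotoneOn_of_deriv_nonneg (convex_Ici 0)
    · exact fun y _ => (hd y).continuousAt.continuousWithinAt
    · exact fun y _ => (hd y).differentiableAt.differentiableWithinAt
    · intro y hy
      simp at hy
      rw [(hd y).deriv]
      have := Real.add_one_le_exp y
      nlinarith
  have := hm (Set.mem_Ici.mpr le_rfl) (Set.mem_Ici.mpr hB) hB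
  simp at this
  linarith

lemma E_low' {A : ℝ} (hA : 2 ≤ A) : 1 / 4 ≤ 1 + (-A - 1) * Real.exp (-A) := by
  have h1 := Real.quadratic_le_exp_of_nonneg (x := A) (by linarith)
  have h2 := Real.exp_pos (-A)
  have h3 : Real.exp A * Real.exp (-A) = 1 := by rw [← Real.exp_add]; simp
  have h4 : 4 * (A + 1) ≤ 3 * Real.exp A := by nlinarith
  nlinarith

lemma A_exp {A : ℝ} (hA : 0 < A) : 1 ≤ Real.exp (A / 2) / A := by
  rw [le_div_iff₀ hA]
  have h1 := Real.quadratic_le_exp_of_nonneg (x := A/2) (by linarith)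
  nlinarith [sq_nonneg (A - 2)]

lemma tv_bound (R K : ℝ → ℝ) (hKa : ∀ y, AnalyticAt ℝ K y)
    (hRp : ∀ y, 0 < R y) (hRE : ∀ y, y ^ 2 * R y ^ 2 = 1 + (y - 1) * Real.exp y)
    (hK : ∀ y, y * K y = Real.exp (-y / 2) - 1 / (Real.sqrt 2 * R y))
    (hS : ∀ y, HasDerivAt (fun y => y * R y) (Real.exp y / (2 * R y)) y) :
    ∃ C : ℝ, 0 < C ∧ ∀ A B : ℝ, 2 ≤ A → 0 < B →
      |K B| + |K (-A)| + ∫ y in (-A)..B, |deriv K y| ≤ C * (Real.exp (A / 2) / A + 1 / B) := by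
  have hs2 : 0 < Real.sqrt 2 := by positivity
  have hs21 : 1 ≤ Real.sqrt 2 := by rw [Real.one_le_sqrt]; norm_num
  have hKc : Continuous (deriv K) := continuous_iff_continuousAt.mpr fun y => (hKa y).deriv.continuousAt
  have hii : ∀ a b, IntervalIntegrable (fun y => |deriv K y|) volume a b :=
    fun a b => hKc.abs.intervalIntegrable a b
  have hKd : ∀ y, HasDerivAt K (deriv K y) y := fun y => (hKa y).differentiableAt.hasDerivAt
  have hKeq : ∀ y, y ≠ 0 → K y = Real.exp (-y / 2) / y - 1 / (Real.sqrt 2 * (y * R y)) := by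
    intro y hy
    have h1 := hK y
    have h2 := hRp y
    have : K y = (Real.exp (-y / 2) - 1 / (Real.sqrt 2 * R y)) / y := by
      rw [← h1]; field_simp
    rw [this]; field_simp
  have hT1 : ∀ y, y ≠ 0 → HasDerivAt (fun y : ℝ => Real.exp (-y / 2) / y)
      (-(Real.exp (-y / 2) * ((y + 2) / (2 * y ^ 2)))) y := by
    intro y hy
    have h1 : HasDerivAt (fun y : ℝ => Real.exp (-y / 2)) (Real.exp (-y / 2) * (-1 / 2)) y :=
      ((hasDerivAt_id y).neg.div_const 2).exp
    refine (h1.div (hasDerivAt_id y) hy).congr_deriv ?_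
    simp; field_simp; ring
  have hT2 : ∀ y, y ≠ 0 → HasDerivAt (fun y : ℝ => 1 / (Real.sqrt 2 * (y * R y)))
      (-(Real.sqrt 2 * (Real.exp y / (2 * R y)) / (Real.sqrt 2 * (y * R y)) ^ 2)) y := by
    intro y hy
    have hr := hRp y
    have h1 := ((hS y).const_mul (Real.sqrt 2)).fun_inv (by positivity)
    simpa [neg_div, div_eq_mul_inv] using h1
  have hKder : ∀ y, y ≠ 0 → deriv K y = -(Real.exp (-y / 2) * ((y + 2) / (2 * y ^ 2))) -
      -(Real.sqrt 2 * (Real.exp y / (2 * R y)) / (Real.sqrt 2 * (y * R y)) ^ 2) := by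
    intro y hy
    rw [← ((hT1 y hy).sub (hT2 y hy)).deriv]
    apply Filter.EventuallyEq.deriv_eq
    filter_upwards [isOpen_ne.mem_nhds hy] with z hz
    simpa using hKeq z hz
  set c1 := ∫ y in (-2 : ℝ)..1, |deriv K y| with hc1
  have hc1n : 0 ≤ c1 := intervalIntegral.integral_nonneg (by norm_num) (fun _ _ => abs_nonneg _)
  set c2 := Real.exp (-1 / 2) / 1 + 1 / (Real.sqrt 2 * (1 * R 1)) with hc2
  have hR1 := hRp 1
  have hc2n : 0 ≤ c2 := by positivity
  -- pieces
  have hleft : ∀ A, 2 ≤ A → ∫ y in (-A)..(-2), |deriv K y| ≤ |K (-2)| + |K (-A)| := by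
    intro A hA
    have h1 : ∫ y in (-A)..(-2), |deriv K y| = ∫ y in (-A)..(-2), deriv K y := by
      apply intervalIntegral.integral_congr
      intro y hy
      rw [Set.uIcc_of_le (by linarith)] at hy
      have hy0 : y ≠ 0 := by linarith [hy.2]
      have hr := hRp y
      apply abs_of_nonneg
      rw [hKder y hy0]
      have e1 : (y + 2) / (2 * y ^ 2) ≤ 0 := div_nonpos_of_nonpos_of_nonneg (by linarith [hy.2]) (by positivity)
      have e2 : 0 ≤ (Real.sqrt 2 * (Real.exp y / (2 * R y)) / (Real.sqrt 2 * (y * R y)) ^ 2) := by positivity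
      have e3 := Real.exp_pos (-y / 2)
      nlinarith
    rw [h1, intervalIntegral.integral_eq_sub_of_hasDerivAt (fun y _ => hKd y) (hKc.intervalIntegrable _ _)]
    have := le_abs_self (K (-2)); have := neg_abs_le (K (-A)); linarith
  have hright : ∀ B, 1 ≤ B → ∫ y in (1:ℝ)..B, |deriv K y| ≤ c2 := by
    intro B hB
    set g : ℝ → ℝ := fun y => Real.exp (-y / 2) * ((y + 2) / (2 * y ^ 2)) +
      (Real.sqrt 2 * (Real.exp y / (2 * R y)) / (Real.sqrt 2 * (y * R y)) ^ 2) with hg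
    have hgc : ContinuousOn g (Set.uIcc 1 B) := by
      intro y hy
      rw [Set.uIcc_of_le hB] at hy
      have hy0 : y ≠ 0 := by linarith [hy.1]
      have hr := hRp y
      have hRc : ContinuousAt R y := by
        have h := ((hS y).continuousAt).div (continuousAt_id) hy0
        refine h.congr ?_
        filter_upwards [isOpen_ne.mem_nhds hy0] with z hz
        have : z ≠ 0 := hz
        simp; field_simp
      apply ContinuousAt.continuousWithinAt
      have h2 : 2 * R y ≠ 0 := by positivity
      have h3 : (Real.sqrt 2 * (y * R y)) ^ 2 ≠ 0 := by positivity
      have h4 : 2 * y ^ 2 ≠ 0 := by positivity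
      simp only [hg]
      fun_prop (disch := assumption)
    have hgi : IntervalIntegrable g volume 1 B := hgc.intervalIntegrable
    have h1 : ∫ y in (1:ℝ)..B, |deriv K y| ≤ ∫ y in (1:ℝ)..B, g y := by
      apply intervalIntegral.integral_mono_on hB (hii _ _) hgi
      intro y hy
      have hy0 : 0 < y := by linarith [hy.1]
      have hr := hRp y
      rw [hKder y hy0.ne']
      have e1 : 0 ≤ Real.exp (-y / 2) * ((y + 2) / (2 * y ^ 2)) := by positivity
      have e2 : 0 ≤ (Real.sqrt 2 * (Real.exp y / (2 * R y)) / (Real.sqrt 2 * (y * R y)) ^ 2) := by positivity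
      simp only [hg]
      rw [abs_le]; constructor <;> linarith
    have h2 : ∫ y in (1:ℝ)..B, g y = -(Real.exp (-B / 2) / B) - 1 / (Real.sqrt 2 * (B * R B)) -
        (-(Real.exp (-1 / 2) / 1) - 1 / (Real.sqrt 2 * (1 * R 1))) := by
      apply intervalIntegral.integral_eq_sub_of_hasDerivAt
        (f := fun y => -(Real.exp (-y / 2) / y) - 1 / (Real.sqrt 2 * (y * R y))) _ hgi
      intro y hy
      rw [Set.uIcc_of_le hB] at hy
      have hy0 : y ≠ 0 := by linarith [hy.1]
      exact ((hT1 y hy0).neg.sub (hT2 y hy0)).congr_deriv (by simp only [hg]; ring)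
    have hRB := hRp B
    have hB0 : 0 < B := by linarith
    have e1 : 0 ≤ Real.exp (-B / 2) / B := by positivity
    have e2 : 0 ≤ 1 / (Real.sqrt 2 * (B * R B)) := by positivity
    rw [h2] at h1
    linarith
  have hKA : ∀ A, 2 ≤ A → |K (-A)| ≤ Real.exp (A / 2) / A + 2 := by
    intro A hA
    have hr := hRp (-A)
    rw [hKeq (-A) (by linarith)]
    have e1 : 1 / 2 ≤ A * R (-A) := by
      have h1 := hRE (-A)
      have h2 := E_low' hA
      have h3 : 0 < A * R (-A) := by positivity
      nlinarith
    have e2 : 1 / (Real.sqrt 2 * (A * R (-A))) ≤ 2 := by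
      rw [div_le_iff₀ (by positivity)]
      nlinarith
    have e3 : 0 ≤ 1 / (Real.sqrt 2 * (A * R (-A))) := by positivity
    have e4 : 0 ≤ Real.exp (A / 2) / A := by positivity
    have e5 : Real.exp (- -A / 2) / -A - 1 / (Real.sqrt 2 * (-A * R (-A))) =
      -(Real.exp (A / 2) / A) + 1 / (Real.sqrt 2 * (A * R (-A))) := by
      rw [neg_neg]; field_simp; ring
    rw [e5, abs_le]; constructor <;> linarith
  have hKB : ∀ B, 0 < B → |K B| ≤ 1 / B := by
    intro B hB
    have hr := hRp B
    rw [hKeq B hB.ne']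
    have e1 : B ≤ Real.sqrt 2 * (B * R B) := by
      have h1 := hRE B
      have h2 := E_low hB.le
      have h3 : 0 < Real.sqrt 2 * (B * R B) := by positivity
      have h4 : (Real.sqrt 2 * (B * R B)) ^ 2 = 2 * (B ^ 2 * R B ^ 2) := by
        rw [mul_pow, Real.sq_sqrt (by norm_num)]; ring
      nlinarith
    have e2 : 1 / (Real.sqrt 2 * (B * R B)) ≤ 1 / B := by gcongr
    have e3 : 0 ≤ 1 / (Real.sqrt 2 * (B * R B)) := by positivity
    have e4 : 0 ≤ Real.exp (-B / 2) / B := by positivity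
    have e5 : Real.exp (-B / 2) / B ≤ 1 / B := by
      gcongr
      rw [Real.exp_le_one_iff]; linarith
    rw [abs_le]; constructor <;> linarith
  refine ⟨c1 + c2 + |K (-2)| + 10, by positivity, ?_⟩
  intro A B hA hB
  have hx := A_exp (A := A) (by linarith)
  have h1 : ∫ y in (-A)..B, |deriv K y| ≤ ∫ y in (-A)..(max B 1), |deriv K y| := by
    apply intervalIntegral.integral_mono_interval le_rfl (by linarith) (le_max_left _ _) _ (hii _ _)
    filter_upwards with y; exact abs_nonneg _
  have h2 : ∫ y in (-A)..(max B 1), |deriv K y| = (∫ y in (-A)..(-2), |deriv K y|) + c1 +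
      ∫ y in (1:ℝ)..(max B 1), |deriv K y| := by
    rw [hc1, intervalIntegral.integral_add_adjacent_intervals (hii _ _) (hii _ _),
      intervalIntegral.integral_add_adjacent_intervals (hii _ _) (hii _ _)]
  have h3 := hleft A hA
  have h4 := hright (max B 1) (le_max_right _ _)
  have h5 := hKA A hA
  have h6 := hKB B hB
  have h7 : 0 < 1 / B := by positivity
  have h8 : 0 ≤ |K (-2)| := abs_nonneg _
  set t := Real.exp (A / 2) / A
  have : (c1 + c2 + |K (-2)|) * 1 ≤ (c1 + c2 + |K (-2)|) * (t + 1 / B) := by gcongr; linarith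
  nlinarith

lemma fres_tail (β : ℂ) (hβ : 0 < β.re) (b : ℝ) (hb : 0 < b) :
    ‖∫ x in Set.Ioi b, Complex.exp (-β * (x:ℂ) ^ 2)‖ ≤ 1 / (‖β‖ * b) := by
  have hβ0 : β ≠ 0 := by rintro rfl; simp at hβ
  have hn : 0 < ‖β‖ := norm_pos_iff.mpr hβ0
  have hint : IntegrableOn (fun x : ℝ => Complex.exp (-β * (x:ℂ) ^ 2)) (Set.Ioi b) :=
    (integrable_cexp_neg_mul_sq hβ).integrableOn
  have ht := intervalIntegral_tendsto_integral_Ioi b hint tendsto_id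
  refine le_of_tendsto ht.norm ?_
  filter_upwards [eventually_ge_atTop b] with T hT
  simp only [id]
  have hne : ∀ x ∈ Set.uIcc b T, (x:ℂ) ≠ 0 := by
    intro x hx
    rw [Set.uIcc_of_le hT] at hx
    exact_mod_cast (lt_of_lt_of_le hb hx.1).ne'
  have hnr : ∀ x ∈ Set.uIcc b T, x ≠ 0 := by
    intro x hx
    exact_mod_cast hne x hx
  have hE : ∀ x : ℝ, ‖Complex.exp (-β * (x:ℂ) ^ 2)‖ ≤ 1 := by
    intro x
    rw [Complex.norm_exp, Real.exp_le_one_iff]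
    have : (-β * (x:ℂ) ^ 2).re = - (β.re * x ^ 2) := by
      rw [← Complex.ofReal_pow, Complex.re_mul_ofReal]; simp
    rw [this]; have := mul_nonneg hβ.le (sq_nonneg x); linarith
  have h1 : ∫ x in b..T, Complex.exp (-β * (x:ℂ) ^ 2) =
      (∫ x in b..T, (-1 / (2 * β * x) : ℂ) * (Complex.exp (-β * (x:ℂ) ^ 2) * (-β * (2 * x)))) := by
    apply intervalIntegral.integral_congr
    intro x hx
    have := hne x hx
    simp only
    field_simp
  have h2 : ∀ x ∈ Set.uIcc b T, HasDerivAt (fun x : ℝ => (-1 / (2 * β * x) : ℂ))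
      (1 / (2 * β * (x:ℂ)^2)) x := by
    intro x hx
    have hx0 := hne x hx
    have := ((hasDerivAt_id x).ofReal_comp.const_mul (2*β)).fun_inv (by simpa using ⟨hβ0, hnr x hx⟩)
    have h4 := (this.const_mul (-1 : ℂ)).congr_deriv (g' := 1 / (2 * β * (x:ℂ)^2)) (by simp; field_simp)
    simpa [div_eq_mul_inv] using h4
  have h3 : ∀ x ∈ Set.uIcc b T, HasDerivAt (fun x : ℝ => Complex.exp (-β * (x:ℂ) ^ 2))
      (Complex.exp (-β * (x:ℂ) ^ 2) * (-β * (2 * x))) x := by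
    intro x hx
    have := (((hasDerivAt_id x).ofReal_comp.pow 2).const_mul (-β)).cexp
    exact this.congr_deriv (by simp)
  have hr : ∀ x ∈ Set.uIcc b T, HasDerivAt (fun x : ℝ => - 1 / (2 * ‖β‖ * x)) (1 / (2 * ‖β‖ * x ^ 2)) x := by
    intro x hx
    have hx0 := hnr x hx
    have := ((hasDerivAt_id x).const_mul (2*‖β‖)).fun_inv (by simpa using ⟨hβ0, hx0⟩)
    have h4 := (this.const_mul (-1 : ℝ)).congr_deriv (g' := 1 / (2 * ‖β‖ * x ^ 2)) (by simp; field_simp)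
    simpa [div_eq_mul_inv] using h4
  have hci : IntervalIntegrable (fun x : ℝ => 1 / (2 * ‖β‖ * x ^ 2)) volume b T := by
    apply ContinuousOn.intervalIntegrable
    intro x hx
    have hx0 := hnr x hx
    apply ContinuousAt.continuousWithinAt
    fun_prop (disch := positivity)
  rw [h1, intervalIntegral.integral_mul_deriv_eq_deriv_mul h2 h3]
  · have e1 : ‖(-1 / (2 * β * T) : ℂ) * Complex.exp (-β * (T:ℂ) ^ 2)‖ ≤ 1 / (2 * ‖β‖ * T) := by
      rw [norm_mul]
      have hT0 : 0 < T := by linarith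
      calc _ ≤ ‖(-1 / (2 * β * T) : ℂ)‖ * 1 := by gcongr; exact hE T
        _ = _ := by simp [abs_of_pos hT0]
    have e2 : ‖(-1 / (2 * β * b) : ℂ) * Complex.exp (-β * (b:ℂ) ^ 2)‖ ≤ 1 / (2 * ‖β‖ * b) := by
      rw [norm_mul]
      calc _ ≤ ‖(-1 / (2 * β * b) : ℂ)‖ * 1 := by gcongr; exact hE b
        _ = _ := by simp [abs_of_pos hb]
    have e3 : ‖∫ x in b..T, (1 / (2 * β * (x:ℂ)^2)) * Complex.exp (-β * (x:ℂ) ^ 2)‖ ≤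
        ∫ x in b..T, 1 / (2 * ‖β‖ * x ^ 2) := by
      apply intervalIntegral.norm_integral_le_of_norm_le hT _ hci
      filter_upwards with x hx
      rw [norm_mul]
      calc _ ≤ ‖(1 / (2 * β * (x:ℂ)^2) : ℂ)‖ * 1 := by gcongr; exact hE x
        _ = _ := by simp
    rw [intervalIntegral.integral_eq_sub_of_hasDerivAt hr hci] at e3
    have : 1 / (‖β‖ * b) = 1 / (2 * ‖β‖ * b) + 1 / (2 * ‖β‖ * b) := by field_simp; norm_num
    rw [this]
    refine (norm_sub_le _ _).trans ?_
    have := norm_sub_le ((-1 / (2 * β * T) : ℂ) * Complex.exp (-β * (T:ℂ) ^ 2)) ((-1 / (2 * β * b) : ℂ) * Complex.exp (-β * (b:ℂ) ^ 2))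
    rw [neg_div, neg_div] at e3
    linarith
  · apply ContinuousOn.intervalIntegrable
    intro x hx
    have hx0 := hne x hx
    apply ContinuousAt.continuousWithinAt
    have : (2 * β * (x:ℂ)^2) ≠ 0 := by simp [hβ0, hx0]
    fun_prop (disch := assumption)
  · apply Continuous.intervalIntegrable
    fun_prop

lemma fres_const (Λ : ℝ) (hΛ : 0 < Λ) : ((Real.pi : ℂ) / (Complex.I * Λ)) ^ (1/2 : ℂ) =
    (Real.sqrt (Real.pi / Λ) : ℂ) * Complex.exp (-(2 * (Real.pi : ℂ) * Complex.I) / 8) := by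
  have hp := Real.pi_pos
  have h1 : ((Real.pi : ℂ) / (Complex.I * Λ)) = ((Real.pi / Λ : ℝ) : ℂ) * (-Complex.I) := by
    have : (Λ : ℂ) ≠ 0 := by exact_mod_cast hΛ.ne'
    push_cast; field_simp; simp
  have h2 : (0:ℝ) < Real.pi / Λ := by positivity
  have hI : (-Complex.I) ≠ 0 := by simp
  have h0 : ((Real.pi / Λ : ℝ) : ℂ) * (-Complex.I) ≠ 0 := mul_ne_zero (by exact_mod_cast h2.ne') hI
  rw [h1, Complex.cpow_def_of_ne_zero h0, Complex.log_ofReal_mul h2 hI, Complex.log_neg_I,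
    Real.sqrt_eq_rpow, Real.rpow_def_of_pos h2]
  push_cast
  rw [← Complex.exp_add]
  congr 1
  ring

lemma fres (Λ : ℝ) (hΛ : 0 < Λ) (b : ℝ) (hb : 0 < b) :
    ‖(∫ x in (0:ℝ)..b, Complex.exp (-(Complex.I * Λ) * (x:ℂ) ^ 2)) -
      (Real.sqrt (Real.pi / Λ) : ℂ) * Complex.exp (-(2 * (Real.pi : ℂ) * Complex.I) / 8) / 2‖
      ≤ 1 / (Λ * b) := by
  rw [← fres_const Λ hΛ]
  have hI : Tendsto (fun ε : ℝ => (ε : ℂ) + Complex.I * Λ) (𝓝[>] 0) (𝓝 (Complex.I * Λ)) := by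
    have : Continuous (fun ε : ℝ => (ε : ℂ) + Complex.I * Λ) := by fun_prop
    have := (this.tendsto 0).mono_left (nhdsWithin_le_nhds (s := Set.Ioi 0))
    simpa using this
  have hI0 : Complex.I * Λ ≠ 0 := by simp [hΛ.ne']
  have hc : ContinuousAt (fun β : ℂ => (∫ x in (0:ℝ)..b, Complex.exp (-β * (x:ℂ) ^ 2)) -
      ((Real.pi : ℂ) / β) ^ (1/2 : ℂ) / 2) (Complex.I * Λ) := by
    apply ContinuousAt.sub
    · apply Continuous.continuousAt
      apply intervalIntegral.continuous_parametric_intervalIntegral_of_continuous'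
      simp only [Function.uncurry_def]
      fun_prop
    · apply ContinuousAt.div_const
      apply ContinuousAt.cpow
      · fun_prop (disch := assumption)
      · fun_prop
      · right
        have : (Λ : ℂ) ≠ 0 := by exact_mod_cast hΛ.ne'
        have h1 : ((Real.pi : ℂ) / (Complex.I * Λ)) = ((Real.pi / Λ : ℝ) : ℂ) * (-Complex.I) := by
          push_cast; field_simp; simp
        rw [h1, Complex.im_ofReal_mul]
        simp [hΛ.ne', Real.pi_ne_zero]
  refine le_of_tendsto (hc.tendsto.comp hI).norm ?_
  filter_upwards [self_mem_nhdsWithin] with ε (hε : 0 < ε)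
  simp only [Function.comp]
  set β := (ε : ℂ) + Complex.I * Λ with hβd
  have hre : 0 < β.re := by simp [hβd, hε]
  have hnorm : Λ ≤ ‖β‖ := by
    have := Complex.abs_im_le_norm β
    simp [hβd] at this
    rw [abs_of_pos hΛ] at this
    exact this
  rw [← integral_gaussian_complex_Ioi hre]
  have hint := integrable_cexp_neg_mul_sq hre
  rw [← intervalIntegral.integral_interval_add_Ioi (hint.integrableOn (s := Set.Ioi 0)) (hint.integrableOn (s := Set.Ioi b))]
  rw [sub_add_cancel_left, norm_neg]
  refine (fres_tail β hre b hb).trans ?_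
  gcongr

lemma core_int : ∃ C : ℝ, 0 < C ∧ ∀ A B Λ : ℝ, 2 ≤ A → 0 < B → 0 < Λ →
    ‖(∫ y in (-A)..B, Complex.exp (-(Complex.I * Λ) * ((1 + (y - 1) * Real.exp y : ℝ) : ℂ)) *
        ((Real.exp (y / 2) : ℝ) : ℂ)) -
      (Real.sqrt 2 : ℂ) * ((Real.sqrt (Real.pi / Λ) : ℂ) *
        Complex.exp (-(2 * (Real.pi : ℂ) * Complex.I) / 8))‖
      ≤ C / Λ * (Real.exp (A / 2) / A + 1 / B) := by
  obtain ⟨R, K, hRa, hKa, hRp, hRE, hK, hS⟩ := exists_RK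
  obtain ⟨C, hC, hTV⟩ := tv_bound R K hKa hRp hRE hK hS
  refine ⟨C + 10, by positivity, ?_⟩
  intro A B Λ hA hB hΛ
  have hs2 : 0 < Real.sqrt 2 := by positivity
  have hs2s : Real.sqrt 2 ^ 2 = 2 := Real.sq_sqrt (by norm_num)
  have hRc : Continuous R := continuous_iff_continuousAt.mpr fun y => (hRa y).continuousAt
  have hKc : Continuous K := continuous_iff_continuousAt.mpr fun y => (hKa y).continuousAt
  have hK'c : Continuous (deriv K) := continuous_iff_continuousAt.mpr fun y => (hKa y).deriv.continuousAt
  have hKd : ∀ y, HasDerivAt K (deriv K y) y := fun y => (hKa y).differentiableAt.hasDerivAt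
  set w := (Real.sqrt (Real.pi / Λ) : ℂ) * Complex.exp (-(2 * (Real.pi : ℂ) * Complex.I) / 8) with hw
  set ex : ℝ → ℂ := fun y => Complex.exp (-(Complex.I * Λ) * ((1 + (y - 1) * Real.exp y : ℝ) : ℂ)) with hex
  have hexc : Continuous ex := by simp only [hex]; fun_prop
  have hexn : ∀ y, ‖ex y‖ = 1 := by
    intro y
    simp only [hex]
    rw [Complex.norm_exp]
    simp [-Complex.ofReal_add, -Complex.ofReal_mul, -Complex.ofReal_sub]
  have hΛc : (Λ : ℂ) ≠ 0 := by exact_mod_cast hΛ.ne'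
  have hIΛ : -(Complex.I * Λ) ≠ 0 := by simp [hΛ.ne']
  -- S'
  set s : ℝ → ℝ := fun y => Real.exp y / (2 * R y) with hs
  have hsc : Continuous s := by
    simp only [hs]
    apply Continuous.div (by fun_prop) (by fun_prop)
    intro y; have := hRp y; positivity
  have hdecomp : ∀ y, Real.exp (y / 2) = Real.sqrt 2 * s y + (y * Real.exp y) * K y := by
    intro y
    have h1 := hK y
    have hr := hRp y
    have h2 : (y * Real.exp y) * K y = Real.exp y * (Real.exp (-y / 2) - 1 / (Real.sqrt 2 * R y)) := by
      rw [← h1]; ring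
    have h3 : Real.exp y * Real.exp (-y / 2) = Real.exp (y / 2) := by
      rw [← Real.exp_add]; congr 1; ring
    rw [h2, mul_sub, h3]
    simp only [hs]
    field_simp
    rw [hs2s]; ring
  have hsplit : (∫ y in (-A)..B, ex y * ((Real.exp (y / 2) : ℝ) : ℂ)) =
      (Real.sqrt 2 : ℂ) * (∫ y in (-A)..B, (s y : ℝ) • ex y) +
      ∫ y in (-A)..B, (K y : ℂ) * (ex y * ((y * Real.exp y : ℝ) : ℂ)) := by
    rw [← intervalIntegral.integral_const_mul, ← intervalIntegral.integral_add]
    · apply intervalIntegral.integral_congr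
      intro y _
      simp only
      rw [hdecomp y, Complex.real_smul]
      push_cast; ring
    · apply Continuous.intervalIntegrable; fun_prop
    · apply Continuous.intervalIntegrable; fun_prop
  have hfr : (∫ y in (-A)..B, (s y : ℝ) • ex y) =
      ∫ x in (-A * R (-A))..(B * R B), Complex.exp (-(Complex.I * Λ) * (x:ℂ) ^ 2) := by
    rw [← intervalIntegral.integral_deriv_smul_comp (f := fun y => y * R y) (f' := s)
      (g := fun x : ℝ => Complex.exp (-(Complex.I * Λ) * (x:ℂ) ^ 2)) (fun y _ => hS y) hsc.continuousOn
      (by fun_prop)]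
    apply intervalIntegral.integral_congr
    intro y _
    simp only [hex, Function.comp]
    rw [← hRE y]; push_cast; congr 2; ring
  set a := A * R (-A) with ha
  set b := B * R B with hb
  have hrA := hRp (-A)
  have hrB := hRp B
  have ha2 : 1 / 2 ≤ a := by
    have h1 := hRE (-A)
    have h2 := E_low' hA
    have h3 : 0 < A * R (-A) := by positivity
    nlinarith
  have hb2 : B ≤ Real.sqrt 2 * b := by
    have h1 := hRE B
    have h2 := E_low hB.le
    have h3 : 0 < Real.sqrt 2 * (B * R B) := by positivity
    have h4 : (Real.sqrt 2 * (B * R B)) ^ 2 = 2 * (B ^ 2 * R B ^ 2) := by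
      rw [mul_pow, Real.sq_sqrt (by norm_num)]; ring
    nlinarith
  have hbpos : 0 < b := by positivity
  have hapos : 0 < a := by positivity
  have hfr2 : (∫ x in (-A * R (-A))..(B * R B), Complex.exp (-(Complex.I * Λ) * (x:ℂ) ^ 2)) =
      (∫ x in (0:ℝ)..a, Complex.exp (-(Complex.I * Λ) * (x:ℂ) ^ 2)) +
      ∫ x in (0:ℝ)..b, Complex.exp (-(Complex.I * Λ) * (x:ℂ) ^ 2) := by
    have hcont : Continuous (fun x : ℝ => Complex.exp (-(Complex.I * Λ) * (x:ℂ) ^ 2)) := by fun_prop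
    rw [← intervalIntegral.integral_add_adjacent_intervals (hcont.intervalIntegrable _ 0) (hcont.intervalIntegrable 0 _)]
    congr 1
    have := intervalIntegral.integral_comp_neg (a := 0) (b := a)
      (fun x : ℝ => Complex.exp (-(Complex.I * Λ) * (x:ℂ) ^ 2))
    rw [neg_zero] at this
    rw [neg_mul, ← ha, ← this]
    simp
  have hF : ‖(∫ y in (-A)..B, (s y : ℝ) • ex y) - w‖ ≤ 1 / (Λ * a) + 1 / (Λ * b) := by
    rw [hfr, hfr2]
    have e1 := fres Λ hΛ a hapos
    have e2 := fres Λ hΛ b hbpos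
    rw [← hw] at e1 e2
    refine le_trans ?_ (add_le_add e1 e2)
    refine le_trans (le_of_eq ?_) (norm_add_le _ _)
    congr 1; ring
  -- by parts
  have hexd : ∀ y, HasDerivAt (fun y => ex y / (-(Complex.I * Λ))) (ex y * ((y * Real.exp y : ℝ) : ℂ)) y := by
    intro y
    have h1 := (((E_deriv y).ofReal_comp).const_mul (-(Complex.I * Λ))).cexp
    refine (h1.div_const (-(Complex.I * Λ))).congr_deriv ?_
    simp only [hex]
    field_simp
  have hvn : ∀ y, ‖ex y / (-(Complex.I * Λ))‖ = 1 / Λ := by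
    intro y; rw [norm_div, hexn]; simp [abs_of_pos hΛ]
  have hP : ‖∫ y in (-A)..B, (K y : ℂ) * (ex y * ((y * Real.exp y : ℝ) : ℂ))‖ ≤
      C / Λ * (Real.exp (A / 2) / A + 1 / B) := by
    rw [intervalIntegral.integral_mul_deriv_eq_deriv_mul (u' := fun y => ((deriv K y : ℝ) : ℂ))
      (fun y _ => (hKd y).ofReal_comp) (fun y _ => hexd y)
      (by apply Continuous.intervalIntegrable; fun_prop)
      (by apply Continuous.intervalIntegrable; fun_prop)]
    have e1 : ‖∫ y in (-A)..B, ((deriv K y : ℝ) : ℂ) * (ex y / (-(Complex.I * Λ)))‖ ≤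
        ∫ y in (-A)..B, |deriv K y| * (1 / Λ) := by
      apply intervalIntegral.norm_integral_le_of_norm_le (by linarith)
      · filter_upwards with y _
        rw [norm_mul, hvn]; simp
      · apply Continuous.intervalIntegrable; fun_prop
    rw [intervalIntegral.integral_mul_const] at e1
    refine (norm_sub_le _ _).trans ?_
    refine (add_le_add (norm_sub_le _ _) e1).trans ?_
    rw [norm_mul, norm_mul, hvn, hvn, Complex.norm_real, Complex.norm_real, Real.norm_eq_abs, Real.norm_eq_abs]
    have := hTV A B hA hB
    calc _ = (1 / Λ) * (|K B| + |K (-A)| + ∫ y in (-A)..B, |deriv K y|) := by ring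
      _ ≤ (1 / Λ) * (C * (Real.exp (A / 2) / A + 1 / B)) := by gcongr
      _ = _ := by ring
  rw [hsplit]
  have hfin : (Real.sqrt 2 : ℂ) * (∫ y in (-A)..B, (s y : ℝ) • ex y) +
      (∫ y in (-A)..B, (K y : ℂ) * (ex y * ((y * Real.exp y : ℝ) : ℂ))) - (Real.sqrt 2 : ℂ) * w =
      (Real.sqrt 2 : ℂ) * ((∫ y in (-A)..B, (s y : ℝ) • ex y) - w) +
      (∫ y in (-A)..B, (K y : ℂ) * (ex y * ((y * Real.exp y : ℝ) : ℂ))) := by ring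
  rw [hfin]
  refine (norm_add_le _ _).trans ?_
  rw [norm_mul, Complex.norm_real, Real.norm_of_nonneg hs2.le]
  have hx := A_exp (A := A) (by linarith)
  have hs22 : Real.sqrt 2 ≤ 2 := by nlinarith
  have g1 : 1 / (Λ * a) ≤ 1 / Λ * 2 := by
    rw [div_mul_eq_mul_div, div_le_div_iff₀ (by positivity) hΛ]
    nlinarith
  have g2 : 1 / (Λ * b) ≤ 1 / Λ * (2 * (1 / B)) := by
    have : 1 / b ≤ 2 * (1 / B) := by
      rw [mul_one_div, div_le_div_iff₀ hbpos hB]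
      nlinarith
    calc 1 / (Λ * b) = 1 / Λ * (1 / b) := by field_simp
      _ ≤ _ := by gcongr
  have hB1 : 0 < 1 / B := by positivity
  have hL1 : 0 < 1 / Λ := by positivity
  set t := Real.exp (A / 2) / A
  calc _ ≤ 2 * (1 / Λ * 2 + 1 / Λ * (2 * (1 / B))) + C / Λ * (t + 1 / B) := by
        gcongr
        exact hF.trans (add_le_add g1 g2)
    _ = 1 / Λ * (4 + 4 * (1 / B)) + C / Λ * (t + 1 / B) := by ring
    _ ≤ 1 / Λ * (10 * (t + 1 / B)) + C / Λ * (t + 1 / B) := by gcongr; linarith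
    _ = _ := by ring

lemma stat_phase (d : ℝ) (hd : 0 < d) : ∃ C : ℝ, 0 < C ∧ ∀ X N u0 : ℝ, 0 < X → Real.exp 2 * X ≤ u0 → u0 < N →
    ‖(∫ x in X..N, Complex.exp (2 * (Real.pi : ℂ) * Complex.I *
        ((d * x * (1 + Real.log (u0 / x)) : ℝ) : ℂ)) / ((Real.sqrt x : ℝ) : ℂ)) -
      (Complex.exp (-(2 * (Real.pi : ℂ) * Complex.I) / 8) / ((Real.sqrt d : ℝ) : ℂ)) *
        Complex.exp (2 * (Real.pi : ℂ) * Complex.I * ((d * u0 : ℝ) : ℂ))‖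
      ≤ C / Real.sqrt X * (1 / Real.log (u0 / X) + 1 / Real.log (N / u0)) := by
  obtain ⟨C, hC, hcore⟩ := core_int
  have hpi := Real.pi_pos
  refine ⟨C / (2 * Real.pi * d), by positivity, ?_⟩
  intro X N u0 hX hXu huN
  have hu : 0 < u0 := lt_of_lt_of_le (by positivity) hXu
  have hN : 0 < N := hu.trans huN
  set A := Real.log (u0 / X) with hA
  set B := Real.log (N / u0) with hB
  have hA2 : 2 ≤ A := by
    rw [hA, Real.le_log_iff_exp_le (by positivity), le_div_iff₀ hX]; exact hXu
  have hB0 : 0 < B := Real.log_pos (by rw [lt_div_iff₀ hu]; linarith)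
  set Λ := 2 * Real.pi * d * u0 with hΛd
  have hΛ : 0 < Λ := by positivity
  have hsu : 0 < Real.sqrt u0 := Real.sqrt_pos.mpr hu
  have hsX : 0 < Real.sqrt X := Real.sqrt_pos.mpr hX
  have hsd : 0 < Real.sqrt d := Real.sqrt_pos.mpr hd
  have hcA : u0 * Real.exp (-A) = X := by
    rw [Real.exp_neg, hA, Real.exp_log (by positivity)]; field_simp
  have hcB : u0 * Real.exp B = N := by
    rw [hB, Real.exp_log (by positivity)]; field_simp
  set g : ℝ → ℂ := fun x => Complex.exp (2 * (Real.pi : ℂ) * Complex.I *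
        ((d * x * (1 + Real.log (u0 / x)) : ℝ) : ℂ)) / ((Real.sqrt x : ℝ) : ℂ) with hg
  set L := Complex.exp (2 * (Real.pi : ℂ) * Complex.I * ((d * u0 : ℝ) : ℂ)) with hL
  have hLn : ‖L‖ = 1 := by
    rw [hL, Complex.norm_exp]
    simp [-Complex.ofReal_mul]
  have hsub : (∫ x in X..N, g x) = ∫ y in (-A)..B, (u0 * Real.exp y) • (g ∘ fun y => u0 * Real.exp y) y := by
    rw [intervalIntegral.integral_deriv_smul_comp' (f := fun y => u0 * Real.exp y) (f' := fun y => u0 * Real.exp y)]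
    · simp only [hcA, hcB]
    · exact fun y _ => (Real.hasDerivAt_exp y).const_mul u0
    · fun_prop
    · rintro x ⟨y, _, rfl⟩
      have hx : 0 < u0 * Real.exp y := by positivity
      apply ContinuousAt.continuousWithinAt
      simp only [hg]
      have h1 : u0 / (u0 * Real.exp y) ≠ 0 := by positivity
      have h2 : ((Real.sqrt (u0 * Real.exp y) : ℝ) : ℂ) ≠ 0 := by
        have := Real.sqrt_pos.mpr hx
        exact_mod_cast this.ne'
      have h3 : u0 * Real.exp y ≠ 0 := hx.ne'
      fun_prop (disch := assumption)
  have hpt : ∀ y : ℝ, (u0 * Real.exp y) • (g ∘ fun y => u0 * Real.exp y) y =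
      ((Real.sqrt u0 : ℂ) * L) * (Complex.exp (-(Complex.I * Λ) * ((1 + (y - 1) * Real.exp y : ℝ) : ℂ)) *
        ((Real.exp (y / 2) : ℝ) : ℂ)) := by
    intro y
    simp only [Function.comp, hg]
    have h1 : Real.log (u0 / (u0 * Real.exp y)) = -y := by
      rw [← div_div, div_self hu.ne', Real.log_div one_ne_zero (Real.exp_pos y).ne', Real.log_exp]; simp
    have h2 : Real.sqrt (u0 * Real.exp y) = Real.sqrt u0 * Real.exp (y / 2) := by
      rw [Real.sqrt_mul hu.le, Real.exp_half]
    have h3 : u0 * Real.exp y = Real.sqrt u0 * Real.exp (y / 2) * (Real.sqrt u0 * Real.exp (y / 2)) := by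
      rw [← h2, Real.mul_self_sqrt (by positivity)]
    have h4 : Complex.exp (2 * (Real.pi : ℂ) * Complex.I *
        ((d * (u0 * Real.exp y) * (1 + -y) : ℝ) : ℂ)) =
        L * Complex.exp (-(Complex.I * Λ) * ((1 + (y - 1) * Real.exp y : ℝ) : ℂ)) := by
      rw [hL, ← Complex.exp_add, hΛd]
      congr 1; push_cast; ring
    rw [h1, h2, h4, Complex.real_smul]
    have h5 : ((Real.sqrt u0 * Real.exp (y / 2) : ℝ) : ℂ) ≠ 0 := by
      have : 0 < Real.sqrt u0 * Real.exp (y / 2) := by positivity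
      exact_mod_cast this.ne'
    rw [h3, Complex.ofReal_mul (Real.sqrt u0 * Real.exp (y / 2))]
    field_simp
    push_cast
    ring
  have hmain : (Complex.exp (-(2 * (Real.pi : ℂ) * Complex.I) / 8) / ((Real.sqrt d : ℝ) : ℂ)) * L =
      ((Real.sqrt u0 : ℂ) * L) * ((Real.sqrt 2 : ℂ) * ((Real.sqrt (Real.pi / Λ) : ℂ) *
        Complex.exp (-(2 * (Real.pi : ℂ) * Complex.I) / 8))) := by
    have h1 : Real.sqrt u0 * Real.sqrt 2 * Real.sqrt (Real.pi / Λ) = 1 / Real.sqrt d := by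
      rw [← Real.sqrt_mul hu.le, ← Real.sqrt_mul (by positivity), one_div, ← Real.sqrt_inv]
      congr 1
      rw [hΛd]; field_simp
    have h2 : (Real.sqrt u0 : ℂ) * (Real.sqrt 2 : ℂ) * (Real.sqrt (Real.pi / Λ) : ℂ) = 1 / (Real.sqrt d : ℂ) := by
      exact_mod_cast h1
    calc _ = (1 / (Real.sqrt d : ℂ)) * (L * Complex.exp (-(2 * (Real.pi : ℂ) * Complex.I) / 8)) := by ring
      _ = _ := by rw [← h2]; ring
  rw [hsub, intervalIntegral.integral_congr (fun y _ => hpt y), intervalIntegral.integral_const_mul, hmain,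
    ← mul_sub, norm_mul, norm_mul, hLn, mul_one, Complex.norm_real, Real.norm_of_nonneg hsu.le]
  have hc := hcore A B Λ hA2 hB0 hΛ
  have hAu : Real.exp (A / 2) = Real.sqrt u0 / Real.sqrt X := by
    rw [Real.exp_half, hA, Real.exp_log (by positivity), Real.sqrt_div hu.le]
  have hXu' : Real.sqrt X ≤ Real.sqrt u0 := by
    apply Real.sqrt_le_sqrt
    have := Real.one_le_exp (x := 2) (by norm_num)
    nlinarith
  calc _ ≤ Real.sqrt u0 * (C / Λ * (Real.exp (A / 2) / A + 1 / B)) := by gcongr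
    _ = C / (2 * Real.pi * d) * (1 / Real.sqrt X * (1 / A) + 1 / Real.sqrt u0 * (1 / B)) := by
      rw [hAu, hΛd]
      have : u0 = Real.sqrt u0 * Real.sqrt u0 := (Real.mul_self_sqrt hu.le).symm
      set r := Real.sqrt u0
      rw [this]
      field_simp
    _ ≤ C / (2 * Real.pi * d) * (1 / Real.sqrt X * (1 / A) + 1 / Real.sqrt X * (1 / B)) := by gcongr
    _ = _ := by ring

lemma sum_inv (s : Finset ℤ) (c δ L : ℝ) (hδ : 0 < δ) (hL : 0 ≤ L)
    (h1 : ∀ h ∈ s, δ ≤ h - c) (h2 : ∀ h ∈ s, (h:ℝ) - c ≤ L) :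
    ∑ h ∈ s, 1 / ((h:ℝ) - c) ≤ 1 / δ + 1 + Real.log (1 + L) := by
  set h0 := ⌈c + δ⌉ with hh0
  set g : ℕ → ℝ := fun k => if k = 0 then 1 / δ else 1 / (k:ℝ) with hg
  have hg0 : ∀ k, 0 ≤ g k := by
    intro k; simp only [hg]; split_ifs <;> positivity
  have hge : ∀ h ∈ s, h0 ≤ h := by
    intro h hh
    rw [hh0, Int.ceil_le]; linarith [h1 h hh]
  have hc0 : c + δ ≤ h0 := Int.le_ceil _
  have hle : ∀ h ∈ s, 1 / ((h:ℝ) - c) ≤ g (h - h0).toNat := by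
    intro h hh
    have a1 := hge h hh
    simp only [hg]
    split_ifs with hk
    · have := h1 h hh
      gcongr
    · have hk' : 0 < (h - h0).toNat := Nat.pos_of_ne_zero hk
      have e : (((h - h0).toNat : ℕ) : ℝ) = (h:ℝ) - h0 := by
        have : (((h - h0).toNat : ℕ) : ℤ) = h - h0 := Int.toNat_of_nonneg (by linarith)
        exact_mod_cast this
      have e0 : (0:ℝ) < ((h - h0).toNat : ℕ) := by exact_mod_cast hk'
      apply one_div_le_one_div_of_le e0
      rw [e]; linarith
  set n := ⌊L⌋₊ with hn
  have hinj : Set.InjOn (fun h : ℤ => (h - h0).toNat) s := by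
    intro x hx y hy hxy
    have := hge x hx; have := hge y hy
    simp only at hxy
    omega
  have hsub : s.image (fun h : ℤ => (h - h0).toNat) ⊆ Finset.range (n + 1) := by
    intro k hk
    obtain ⟨h, hh, rfl⟩ := Finset.mem_image.mp hk
    rw [Finset.mem_range, Nat.lt_succ_iff, hn, Nat.le_floor_iff hL]
    have e : (((h - h0).toNat : ℕ) : ℝ) = (h:ℝ) - h0 := by
      have : (((h - h0).toNat : ℕ) : ℤ) = h - h0 := Int.toNat_of_nonneg (by linarith [hge h hh])
      exact_mod_cast this
    rw [e]; linarith [h2 h hh]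
  calc _ ≤ ∑ h ∈ s, g (h - h0).toNat := Finset.sum_le_sum hle
    _ = ∑ k ∈ s.image (fun h : ℤ => (h - h0).toNat), g k := (Finset.sum_image hinj).symm
    _ ≤ ∑ k ∈ Finset.range (n + 1), g k := Finset.sum_le_sum_of_subset_of_nonneg hsub (fun _ _ _ => hg0 _)
    _ = (harmonic n : ℝ) + 1 / δ := by
      rw [Finset.sum_range_succ']
      simp [hg, harmonic]
    _ ≤ (1 + Real.log (1 + L)) + 1 / δ := by
      gcongr
      refine (harmonic_le_one_add_log n).trans ?_
      suffices Real.log n ≤ Real.log (1 + L) by linarith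
      rcases Nat.eq_zero_or_pos n with h | h
      · rw [h]; simp; exact Real.log_nonneg (by linarith)
      · apply Real.log_le_log (by exact_mod_cast h)
        linarith [Nat.floor_le hL]
    _ = _ := by ring

lemma sum_inv' (s : Finset ℤ) (c δ L : ℝ) (hδ : 0 < δ) (hL : 0 ≤ L)
    (h1 : ∀ h ∈ s, δ ≤ c - h) (h2 : ∀ h ∈ s, c - (h:ℝ) ≤ L) :
    ∑ h ∈ s, 1 / (c - (h:ℝ)) ≤ 1 / δ + 1 + Real.log (1 + L) := by
  have := sum_inv (s.image (fun h => -h)) (-c) δ L hδ hL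
    (by intro h hh; obtain ⟨k, hk, rfl⟩ := Finset.mem_image.mp hh; push_cast; linarith [h1 k hk])
    (by intro h hh; obtain ⟨k, hk, rfl⟩ := Finset.mem_image.mp hh; push_cast; linarith [h2 k hk])
  rw [Finset.sum_image (fun x _ y _ h => by simpa using h)] at this
  refine le_trans (le_of_eq ?_) this
  apply Finset.sum_congr rfl
  intro h _
  push_cast; congr 1; ring

lemma sum_m (σ C2 : ℝ) (hσ : σ ≤ 0) (hC2 : 1 < C2) : ∃ C : ℝ, 0 < C ∧ ∀ N M : ℕ, 0 < N → 0 < M → (M:ℝ) ≤ C2 * N →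
    ∑ m ∈ Finset.Icc 1 M, 1 / ((m:ℝ) ^ (1 - σ)) ≤ C * (1 + (if σ = 0 then 1 else 0) * Real.log N) := by
  by_cases h : σ = 0
  · subst h
    have hl : 0 < Real.log C2 := Real.log_pos hC2
    refine ⟨1 + Real.log C2, by positivity, ?_⟩
    intro N M hN hM hMN
    have h1 : ∑ m ∈ Finset.Icc 1 M, 1 / ((m:ℝ) ^ ((1:ℝ) - 0)) = (harmonic M : ℝ) := by
      rw [harmonic_eq_sum_Icc]; simp
    rw [h1]
    refine (harmonic_le_one_add_log M).trans ?_
    have hN' : (0:ℝ) < N := by exact_mod_cast hN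
    have h2 : Real.log M ≤ Real.log C2 + Real.log N := by
      rw [← Real.log_mul (by positivity) (by positivity)]
      exact Real.log_le_log (by exact_mod_cast hM) hMN
    have h3 : 0 ≤ Real.log N := Real.log_natCast_nonneg N
    simp only [if_true, one_mul]
    nlinarith
  · have hs : Summable (fun m : ℕ => 1 / ((m:ℝ) ^ (1 - σ))) := by
      rw [Real.summable_one_div_nat_rpow]
      have := lt_of_le_of_ne hσ h; linarith
    refine ⟨(∑' m : ℕ, 1 / ((m:ℝ) ^ (1 - σ))) + 1, ?_, ?_⟩
    · have : 0 ≤ ∑' m : ℕ, 1 / ((m:ℝ) ^ (1 - σ)) := tsum_nonneg (fun m => by positivity)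
      linarith
    · intro N M _ _ _
      simp only [h, if_false, zero_mul, add_zero, mul_one]
      have := hs.sum_le_tsum (Finset.Icc 1 M) (fun m _ => by positivity)
      linarith

lemma per_m (d θ : ℝ) (hd : 0 < d) : ∃ C : ℝ, 0 < C ∧ ∀ (N X m : ℕ) (V : ℝ), 3 ≤ X → X ≤ N → 0 < V → V ≤ 1 / 4 →
    1 ≤ m →
    ‖(∑ h ∈ Finset.Ico ⌈d * Real.log (m / (d * ((1 - V) * N))) + θ⌉
                  ⌈d * Real.log (m / (d * X)) + θ - 2 * d⌉,
                ∫ x in (X : ℝ)..(N : ℝ),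
                  Complex.exp (2 * (Real.pi : ℂ) * Complex.I *
                      ((Fm d θ m x - (h : ℝ) * x : ℝ) : ℂ)) / ((Real.sqrt x : ℝ) : ℂ))
            - (Complex.exp (-(2 * (Real.pi : ℂ) * Complex.I) / 8) /
                  ((Real.sqrt d : ℝ) : ℂ)) *
                  ∑ h ∈ Finset.Ico ⌈d * Real.log (m / (d * ((1 - V) * N))) + θ⌉
                      ⌈d * Real.log (m / (d * X)) + θ - 2 * d⌉,
                    Complex.exp (2 * (Real.pi : ℂ) * Complex.I *
                      (((m : ℝ) * Real.exp ((θ - (h : ℝ)) / d) : ℝ) : ℂ))‖ ≤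
      C * (Real.log (Real.log N) / Real.sqrt X + 1 / (Real.sqrt X * V)) := by
  obtain ⟨C, hC, hsp⟩ := stat_phase d hd
  have hl1 : 0 < Real.log (1 + d) := Real.log_pos (by linarith)
  refine ⟨C * d * (1 / (2 * d) + 4 + 2 * Real.log (1 + d) + 1 / d), by positivity, ?_⟩
  intro N X m V hX3 hXN hV hV4 hm
  have hX : (3:ℝ) ≤ X := by exact_mod_cast hX3
  have hN : (X:ℝ) ≤ N := by exact_mod_cast hXN
  have hX0 : (0:ℝ) < X := by linarith
  have hN0 : (0:ℝ) < N := by linarith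
  have hm0 : (0:ℝ) < m := by exact_mod_cast hm
  have h1V : 0 < 1 - V := by linarith
  have hlogN : 1 ≤ Real.log N := by
    rw [Real.le_log_iff_exp_le hN0]
    have := Real.exp_one_lt_d9; linarith
  have hlX : 0 ≤ Real.log X := Real.log_nonneg (by linarith)
  have hll : 0 ≤ Real.log (Real.log N) := Real.log_nonneg hlogN
  set s := Finset.Ico ⌈d * Real.log (m / (d * ((1 - V) * N))) + θ⌉
                  ⌈d * Real.log (m / (d * X)) + θ - 2 * d⌉ with hs
  set H2 := d * Real.log (m / (d * X)) + θ with hH2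
  set H1 := d * Real.log (m / (d * N)) + θ with hH1
  have hdm : Real.log (m / (d * N)) = Real.log m - Real.log d - Real.log N := by
    rw [Real.log_div (by positivity) (by positivity), Real.log_mul (by positivity) (by positivity)]; ring
  have hdx : Real.log (m / (d * X)) = Real.log m - Real.log d - Real.log X := by
    rw [Real.log_div (by positivity) (by positivity), Real.log_mul (by positivity) (by positivity)]; ring
  have hdv : Real.log (m / (d * ((1 - V) * N))) = Real.log m - Real.log d - Real.log (1 - V) - Real.log N := by
    rw [Real.log_div (by positivity) (by positivity), Real.log_mul (by positivity) (by positivity),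
      Real.log_mul (by positivity) (by positivity)]; ring
  have hlV : Real.log (1 - V) ≤ -V := by
    have := Real.log_le_sub_one_of_pos h1V; linarith
  have hlow : ∀ h ∈ s, d * V ≤ h - H1 := by
    intro h hh
    have h1 := Int.ceil_le.mp (Finset.mem_Ico.mp hh).1
    rw [hdv] at h1
    rw [hH1, hdm]
    nlinarith
  have hup : ∀ h ∈ s, 2 * d ≤ H2 - h := by
    intro h hh
    have h1 := Int.lt_ceil.mp (Finset.mem_Ico.mp hh).2
    linarith
  have hdiff : H2 - H1 ≤ d * Real.log N := by
    rw [hH1, hH2, hdm, hdx]; nlinarith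
  have hdV : 0 < d * V := by positivity
  have hL0 : 0 ≤ d * Real.log N := by positivity
  have S1 := sum_inv s H1 (d * V) (d * Real.log N) hdV hL0 hlow
    (fun h hh => by linarith [hup h hh])
  have S2 := sum_inv' s H2 (2 * d) (d * Real.log N) (by positivity) hL0 hup
    (fun h hh => by linarith [hlow h hh])
  have hlog1 : Real.log (1 + d * Real.log N) ≤ Real.log (1 + d) + Real.log (Real.log N) := by
    rw [← Real.log_mul (by positivity) (by positivity)]
    apply Real.log_le_log (by positivity)
    nlinarith
  have hper : ∀ h ∈ s, ‖(∫ x in (X : ℝ)..(N : ℝ),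
                  Complex.exp (2 * (Real.pi : ℂ) * Complex.I *
                      ((Fm d θ m x - (h : ℝ) * x : ℝ) : ℂ)) / ((Real.sqrt x : ℝ) : ℂ)) -
      (Complex.exp (-(2 * (Real.pi : ℂ) * Complex.I) / 8) / ((Real.sqrt d : ℝ) : ℂ)) *
                    Complex.exp (2 * (Real.pi : ℂ) * Complex.I *
                      (((m : ℝ) * Real.exp ((θ - (h : ℝ)) / d) : ℝ) : ℂ))‖ ≤
      C / Real.sqrt X * (d * (1 / (H2 - h) + 1 / (h - H1))) := by
    intro h hh
    set u0 := (m:ℝ) / d * Real.exp ((θ - h) / d) with hu0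
    have hu : 0 < u0 := by positivity
    have hlu : Real.log u0 = Real.log m - Real.log d + (θ - h) / d := by
      rw [hu0, Real.log_mul (by positivity) (by positivity), Real.log_div (by positivity) (by positivity), Real.log_exp]
    have hA : Real.log (u0 / X) = (H2 - h) / d := by
      rw [Real.log_div (by positivity) (by positivity), hlu, hH2, hdx]; field_simp; ring
    have hB : Real.log (N / u0) = (h - H1) / d := by
      rw [Real.log_div (by positivity) (by positivity), hlu, hH1, hdm]; field_simp; ring
    have hlo := hlow h hh
    have hu' := hup h hh
    have c1 : Real.exp 2 * X ≤ u0 := by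
      rw [← le_div_iff₀ hX0, ← Real.le_log_iff_exp_le (by positivity), hA, le_div_iff₀ hd]; exact hu'
    have c2 : u0 < N := by
      have : 0 < Real.log (N / u0) := by rw [hB]; apply div_pos _ hd; linarith
      rw [Real.log_pos_iff (by positivity), lt_div_iff₀ hu] at this
      linarith
    have hmain := hsp X N u0 hX0 c1 c2
    rw [hA, hB] at hmain
    have hfe : ∫ x in (X : ℝ)..(N : ℝ),
                  Complex.exp (2 * (Real.pi : ℂ) * Complex.I *
                      ((Fm d θ m x - (h : ℝ) * x : ℝ) : ℂ)) / ((Real.sqrt x : ℝ) : ℂ) =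
        ∫ x in (X : ℝ)..(N : ℝ), Complex.exp (2 * (Real.pi : ℂ) * Complex.I *
        ((d * x * (1 + Real.log (u0 / x)) : ℝ) : ℂ)) / ((Real.sqrt x : ℝ) : ℂ) := by
      apply intervalIntegral.integral_congr
      intro x hx
      rw [Set.uIcc_of_le hN] at hx
      have hx0 : 0 < x := by linarith [hx.1]
      have : Fm d θ m x - (h : ℝ) * x = d * x * (1 + Real.log (u0 / x)) := by
        rw [Fm, Real.log_div hu.ne' hx0.ne', hlu, Real.log_div (by positivity) (by positivity),
          Real.log_mul (by positivity) (by positivity), Real.log_mul (by positivity) (by positivity), Real.log_exp]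
        field_simp; ring
      simp only [this]
    have hdu : d * u0 = m * Real.exp ((θ - h) / d) := by rw [hu0]; field_simp
    rw [hdu] at hmain
    rw [hfe]
    refine hmain.trans (le_of_eq ?_)
    simp only [one_div_div]
    ring
  rw [Finset.mul_sum, ← Finset.sum_sub_distrib]
  refine (norm_sum_le _ _).trans ((Finset.sum_le_sum hper).trans ?_)
  rw [← Finset.mul_sum, ← Finset.mul_sum, Finset.sum_add_distrib]
  have hsX : 0 < Real.sqrt X := Real.sqrt_pos.mpr hX0
  set ll := Real.log (Real.log N) with hlld
  have hV1 : 1 ≤ 1 / V := by rw [le_div_iff₀ hV]; linarith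
  have e1 : 1 / (d * V) = 1 / d * (1 / V) := by field_simp
  have hd1 : 0 < 1 / d := by positivity
  have hd2 : 0 < 1 / (2 * d) := by positivity
  set W := 1 / V with hW
  have key : (1 / (2 * d) + 1 + Real.log (1 + d * Real.log N)) + (1 / (d * V) + 1 + Real.log (1 + d * Real.log N)) ≤
      (1 / (2 * d) + 4 + 2 * Real.log (1 + d) + 1 / d) * (ll + W) := by
    rw [e1]
    have p1 : (1 / (2 * d)) * 1 ≤ (1 / (2 * d)) * W := by gcongr
    have p2 : 2 * Real.log (1 + d) * 1 ≤ 2 * Real.log (1 + d) * W := by gcongr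
    have p3 : 0 ≤ (1 / (2 * d) + 2 * Real.log (1 + d) + 1 / d) * ll := by positivity
    linarith
  calc _ ≤ C / Real.sqrt X * (d * ((1 / (2 * d) + 4 + 2 * Real.log (1 + d) + 1 / d) * (ll + W))) := by
        gcongr
        linarith
    _ = _ := by rw [hW]; field_simp

theorem statement19 :
    ∃ X₀ : ℕ, ∀ σ d θ C1 C2 : ℝ, σ ≤ 0 → 0 < d → 1 < C1 → C1 < C2 →
      ∃ C > (0 : ℝ), ∀ N M : ℕ, 0 < N → 0 < M → C1 * N ≤ M → (M : ℝ) ≤ C2 * N →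
        ∀ V : ℝ, (N : ℝ) ^ (-(1 : ℝ) / 2) ≤ V → V ≤ 1 / 4 →
        ∀ X : ℕ, 3 ≤ X → X₀ ≤ X → X ≤ M → X ≤ N →
        ‖(∑ m ∈ Finset.Icc 1 M, (1 / ((((m : ℝ) ^ (1 - σ) : ℝ)) : ℂ)) *
              ∑ h ∈ Finset.Ico ⌈d * Real.log (m / (d * ((1 - V) * N))) + θ⌉
                  ⌈d * Real.log (m / (d * X)) + θ - 2 * d⌉,
                ∫ x in (X : ℝ)..(N : ℝ),
                  Complex.exp (2 * (Real.pi : ℂ) * Complex.I *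
                      ((Fm d θ m x - (h : ℝ) * x : ℝ) : ℂ)) / ((Real.sqrt x : ℝ) : ℂ))
            - (Complex.exp (-(2 * (Real.pi : ℂ) * Complex.I) / 8) /
                  ((Real.sqrt d : ℝ) : ℂ)) *
                ∑ m ∈ Finset.Icc 1 M, (1 / ((((m : ℝ) ^ (1 - σ) : ℝ)) : ℂ)) *
                  ∑ h ∈ Finset.Ico ⌈d * Real.log (m / (d * ((1 - V) * N))) + θ⌉
                      ⌈d * Real.log (m / (d * X)) + θ - 2 * d⌉,
                    Complex.exp (2 * (Real.pi : ℂ) * Complex.I *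
                      (((m : ℝ) * Real.exp ((θ - (h : ℝ)) / d) : ℝ) : ℂ))‖
          ≤ C * ((1 + (if σ = 0 then 1 else 0) * Real.log N) *
              (Real.log (Real.log N) / Real.sqrt X + 1 / (Real.sqrt X * V)
                + 1 / ((X : ℝ) ^ ((3 : ℝ) / 2) * V ^ 3))) := by
  refine ⟨3, ?_⟩
  intro σ d θ C1 C2 hσ hd hC1 hC2
  obtain ⟨Ca, hCa, hm⟩ := sum_m σ C2 hσ (by linarith)
  obtain ⟨Cb, hCb, hpm⟩ := per_m d θ hd
  refine ⟨Ca * Cb, by positivity, ?_⟩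
  intro N M hN hM _ hMN V hV hV4 X hX _ _ hXN
  have hN0 : (0:ℝ) < N := by exact_mod_cast hN
  have hV0 : 0 < V := lt_of_lt_of_le (Real.rpow_pos_of_pos hN0 _) hV
  have hX0 : (0:ℝ) < X := by exact_mod_cast (by omega : 0 < X)
  rw [Finset.mul_sum, ← Finset.sum_sub_distrib]
  have hlogN : 1 ≤ Real.log N := by
    rw [Real.le_log_iff_exp_le hN0]
    have := Real.exp_one_lt_d9
    have : (3:ℝ) ≤ N := by exact_mod_cast (by omega : 3 ≤ N)
    linarith
  have hll : 0 ≤ Real.log (Real.log N) := Real.log_nonneg hlogN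
  set T := Real.log (Real.log N) / Real.sqrt X + 1 / (Real.sqrt X * V) with hT
  have hT0 : 0 ≤ T := by positivity
  have hE : 0 ≤ 1 / ((X : ℝ) ^ ((3 : ℝ) / 2) * V ^ 3) := by positivity
  calc _ ≤ ∑ m ∈ Finset.Icc 1 M, 1 / ((m:ℝ) ^ (1 - σ)) * (Cb * T) := by
        refine (norm_sum_le _ _).trans (Finset.sum_le_sum ?_)
        intro m hmm
        have h1 := hpm N X m V hX hXN hV0 hV4 (Finset.mem_Icc.mp hmm).1
        rw [mul_left_comm (Complex.exp (-(2 * (Real.pi : ℂ) * Complex.I) / 8) / ((Real.sqrt d : ℝ) : ℂ)), ← mul_sub, norm_mul]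
        have h2 : ‖(1 / ((((m : ℝ) ^ (1 - σ) : ℝ)) : ℂ))‖ = 1 / ((m:ℝ) ^ (1 - σ)) := by
          rw [norm_div, norm_one, Complex.norm_real, Real.norm_of_nonneg (by positivity)]
        rw [h2]
        gcongr
    _ = (∑ m ∈ Finset.Icc 1 M, 1 / ((m:ℝ) ^ (1 - σ))) * (Cb * T) := by rw [Finset.sum_mul]
    _ ≤ (Ca * (1 + (if σ = 0 then 1 else 0) * Real.log N)) * (Cb * T) := by
        gcongr
        exact hm N M hN hM hMN
    _ = Ca * Cb * ((1 + (if σ = 0 then 1 else 0) * Real.log N) * T) := by ring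
    _ ≤ _ := by
        gcongr
        linarith
end
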